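/- Let n and k ≥ 0 satisfy n ≥ 3k + 2, and set λ = (3^k, 2, 1^{n−2−3k}), the partition of n with k parts equal to 3, one part equal to 2, and n−2−3k parts equal to 1. If μ is a partition of n with O_λ ≤ O_μ, then μ is one of the following: (1) μ = (3^l, 2, 1^{n−2−3l}) with 0 ≤ l ≤ k; (2) μ = (5, 3^l, 1^{n−5−3l}) with 0 ≤ l ≤ k−1; (3) μ = (3^l, 1^{n−3l}) for some l ≥ 0 with 3l ≤ n. Moreover, if μ is any partition of form (1) or (2), then O_λ ≤ O_μ. -/

import Mathlib

/-- A word in the adjacent transpositions `s_i = (i, i+1)` (0-based: `swap i (i+1)`),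
the standard Coxeter generators of `𝔖_n = Equiv.Perm (Fin n)`. -/
def IsAdjWord (n : ℕ) (l : List (Equiv.Perm (Fin n))) : Prop :=
  ∀ x ∈ l, ∃ i : ℕ, ∃ h : i + 1 < n, x = Equiv.swap ⟨i, Nat.lt_of_succ_lt h⟩ ⟨i + 1, h⟩

/-- The Coxeter length of a permutation: the minimal length of an expression as a
product of adjacent transpositions. -/
noncomputable def permLength (n : ℕ) (w : Equiv.Perm (Fin n)) : ℕ :=
  sInf {k | ∃ l : List (Equiv.Perm (Fin n)), IsAdjWord n l ∧ l.length = k ∧ l.prod = w}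

/-- The Bruhat order on `𝔖_n`: `x ≤ y` iff some reduced expression of `y` contains a
subword that is a reduced expression of `x`. -/
def permBruhatLE (n : ℕ) (x y : Equiv.Perm (Fin n)) : Prop :=
  ∃ l : List (Equiv.Perm (Fin n)), IsAdjWord n l ∧ l.prod = y ∧ l.length = permLength n y ∧
    ∃ l' : List (Equiv.Perm (Fin n)), l'.Sublist l ∧ l'.prod = x ∧ l'.length = permLength n x

/-- The cycle type of a permutation of `{1,…,n}`, including fixed points as parts equal
to `1`; this is a partition of `n`, regarded as a multiset. -/
def fullCycleType (n : ℕ) (w : Equiv.Perm (Fin n)) : Multiset ℕ :=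
  w.cycleType + Multiset.replicate (n - w.cycleType.sum) 1

/-- Membership in the `F`-conjugacy class `O_μ = {w : w·w₀ has cycle type μ}`, where
`w₀` is the longest element `i ↦ n+1−i` (0-based: `Fin.revPerm`). -/
def inClass (n : ℕ) (mu : Multiset ℕ) (w : Equiv.Perm (Fin n)) : Prop :=
  fullCycleType n (w * Fin.revPerm) = mu

/-- `w` is an element of minimal Coxeter length in the class `O_μ`. -/
def isMinimalIn (n : ℕ) (mu : Multiset ℕ) (w : Equiv.Perm (Fin n)) : Prop :=
  inClass n mu w ∧ ∀ z : Equiv.Perm (Fin n), inClass n mu z → permLength n w ≤ permLength n z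

/-- The partial order on `F`-conjugacy classes: `O_μ ≤ O_λ` iff for every minimal length
element `x` of `O_λ` there is a minimal length element `x'` of `O_μ` with `x' ≤ x`
in the Bruhat order. -/
def classLE (n : ℕ) (mu lam : Multiset ℕ) : Prop :=
  ∀ x : Equiv.Perm (Fin n), isMinimalIn n lam x →
    ∃ x' : Equiv.Perm (Fin n), isMinimalIn n mu x' ∧ permBruhatLE n x' x

section Helpers
open Equiv

/-- Number of ordered pairs whose relative order (w.r.t. labels `f`) is kept by `g`. -/
def KK {n : ℕ} {α : Type*} [LinearOrder α] (g : Perm (Fin n)) (f : Fin n → α) : ℕ :=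
  ∑ a, ∑ b, if (f a < f b ↔ f (g a) < f (g b)) then 1 else 0

/-- `KK` for the standard labelling. -/
def K0 {n : ℕ} (g : Perm (Fin n)) : ℕ := KK g (id : Fin n → Fin n)

lemma sum_pair_compl {n : ℕ} {i j : Fin n} (hij : i ≠ j) (F : Fin n → ℕ) :
    ∑ a, F a = F i + F j + ∑ a ∈ ({i, j} : Finset (Fin n))ᶜ, F a := by
  rw [← Finset.sum_add_sum_compl ({i, j} : Finset (Fin n)), Finset.sum_pair hij]

lemma sum_sum_pair {n : ℕ} {i j : Fin n} (hij : i ≠ j) (F : Fin n → Fin n → ℕ) :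
    ∑ a, ∑ b, F a b = F i i + F i j + F j i + F j j
      + ∑ x ∈ ({i, j} : Finset (Fin n))ᶜ, (F i x + F j x + F x i + F x j)
      + ∑ a ∈ ({i, j} : Finset (Fin n))ᶜ, ∑ b ∈ ({i, j} : Finset (Fin n))ᶜ, F a b := by
  rw [sum_pair_compl hij]
  rw [sum_pair_compl hij (F i), sum_pair_compl hij (F j)]
  rw [Finset.sum_congr rfl (fun a _ => sum_pair_compl hij (F a))]
  simp only [Finset.sum_add_distrib]
  ring

lemma K0_swap {n : ℕ} (g : Perm (Fin n)) {i j : Fin n} (hij : i < j) (hg : g i < g j) :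
    K0 g = K0 (g * swap i j) + 2 +
      4 * (Finset.univ.filter (fun x => i < x ∧ x < j ∧ g i < g x ∧ g x < g j)).card := by
  classical
  have hne : i ≠ j := hij.ne
  unfold K0 KK
  rw [sum_sum_pair hne, sum_sum_pair hne]
  have h1 : ∀ a ∈ ({i, j} : Finset (Fin n))ᶜ, swap i j a = a := by
    intro a ha
    simp at ha
    exact swap_apply_of_ne_of_ne ha.1 ha.2
  have hcard : (Finset.univ.filter (fun x => i < x ∧ x < j ∧ g i < g x ∧ g x < g j)).card
      = ∑ x ∈ ({i, j} : Finset (Fin n))ᶜ, if (i < x ∧ x < j ∧ g i < g x ∧ g x < g j) then 1 else 0 := by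
    rw [Finset.card_filter, sum_pair_compl hne]
    simp
  rw [hcard, Finset.mul_sum]
  have h2 : ∀ x ∈ ({i, j} : Finset (Fin n))ᶜ,
     ((if (id i < id x ↔ id (g i) < id (g x)) then 1 else 0) + (if (id j < id x ↔ id (g j) < id (g x)) then 1 else 0)
      + (if (id x < id i ↔ id (g x) < id (g i)) then 1 else 0) + (if (id x < id j ↔ id (g x) < id (g j)) then 1 else 0) : ℕ)
     = ((if (id i < id x ↔ id ((g * swap i j) i) < id ((g * swap i j) x)) then 1 else 0)
      + (if (id j < id x ↔ id ((g * swap i j) j) < id ((g * swap i j) x)) then 1 else 0)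
      + (if (id x < id i ↔ id ((g * swap i j) x) < id ((g * swap i j) i)) then 1 else 0)
      + (if (id x < id j ↔ id ((g * swap i j) x) < id ((g * swap i j) j)) then 1 else 0))
      + 4 * (if (i < x ∧ x < j ∧ g i < g x ∧ g x < g j) then 1 else 0) := by
    intro x hx
    have hs := h1 x hx
    simp at hx
    have e1 : g x ≠ g i := fun h => hx.1 (g.injective h)
    have e2 : g x ≠ g j := fun h => hx.2 (g.injective h)
    have e3 := hx.1
    have e4 := hx.2
    simp only [Perm.mul_apply, hs, swap_apply_left, swap_apply_right, id]
    generalize g x = X at *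
    generalize g i = I at *
    generalize g j = J at *
    rcases lt_or_gt_of_ne e1 with a1 | a1 <;> rcases lt_or_gt_of_ne e2 with a2 | a2 <;>
    rcases lt_or_gt_of_ne e3 with a3 | a3 <;> rcases lt_or_gt_of_ne e4 with a4 | a4 <;>
    first
    | (exfalso; order)
    | simp [a1, a2, a3, a4, a1.not_gt, a2.not_gt, a3.not_gt, a4.not_gt]
  rw [Finset.sum_congr rfl h2, Finset.sum_add_distrib]
  have h3 : ∀ a ∈ ({i, j} : Finset (Fin n))ᶜ, ∀ b ∈ ({i, j} : Finset (Fin n))ᶜ,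
      (if (id a < id b ↔ id (g a) < id (g b)) then 1 else 0 : ℕ) =
      (if (id a < id b ↔ id ((g * swap i j) a) < id ((g * swap i j) b)) then 1 else 0) := by
    intro a ha b hb
    simp only [Perm.mul_apply, h1 a ha, h1 b hb]
  rw [Finset.sum_congr rfl (fun a ha => Finset.sum_congr rfl (h3 a ha))]
  simp [hij, hg, hij.not_gt, hg.not_gt]
  ring

lemma K0_le {n : ℕ} (g : Perm (Fin n)) : K0 g ≤ n * n := by
  unfold K0 KK
  calc _ ≤ ∑ a : Fin n, ∑ b : Fin n, 1 := by
        gcongr; split_ifs <;> simp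
    _ = n * n := by simp

lemma K0_one {n : ℕ} : K0 (1 : Perm (Fin n)) = n * n := by
  simp [K0, KK]

lemma K0_adj {n : ℕ} (w : Perm (Fin n)) (k : ℕ) (h : k + 1 < n)
    (hw : w ⟨k, by omega⟩ < w ⟨k+1, h⟩) :
    K0 w = K0 (w * swap ⟨k, by omega⟩ ⟨k+1, h⟩) + 2 := by
  rw [K0_swap w (i := ⟨k, by omega⟩) (j := ⟨k+1, h⟩) (by simp) hw]
  simp only [add_eq_left, mul_eq_zero, Finset.card_eq_zero]
  right
  ext x
  simp only [Fin.lt_def, Finset.mem_filter, Finset.mem_univ, true_and, Finset.notMem_empty, iff_false]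
  omega

lemma K0_adj' {n : ℕ} (w : Perm (Fin n)) (k : ℕ) (h : k + 1 < n)
    (hw : w ⟨k+1, h⟩ < w ⟨k, by omega⟩) :
    K0 (w * swap ⟨k, by omega⟩ ⟨k+1, h⟩) = K0 w + 2 := by
  have := K0_adj (w * swap (⟨k, by omega⟩ : Fin n) ⟨k+1, h⟩) k h (by simpa using hw)
  rw [this]
  simp [mul_assoc]

lemma K0_word {n : ℕ} (l : List (Perm (Fin n))) (hl : IsAdjWord n l) :
    n * n ≤ K0 l.prod + 2 * l.length := by
  induction l using List.reverseRecOn with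
  | nil => simp [K0_one]
  | append_singleton l s ih =>
    have h1 : IsAdjWord n l := fun x hx => hl x (by simp [hx])
    obtain ⟨k, hk, rfl⟩ := hl s (by simp)
    have := ih h1
    simp only [List.prod_append, List.prod_singleton, List.length_append, List.length_singleton]
    rcases lt_or_gt_of_ne (a := l.prod ⟨k, by omega⟩) (b := l.prod ⟨k+1, hk⟩)
      (by simp) with h | h
    · have := K0_adj _ k hk h; omega
    · have := K0_adj' _ k hk h; omega

lemma exists_descent {n : ℕ} (w : Perm (Fin n)) (hw : w ≠ 1) :
    ∃ k : ℕ, ∃ h : k + 1 < n, w ⟨k+1, h⟩ < w ⟨k, by omega⟩ := by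
  by_contra hc
  push Not at hc
  apply hw
  have hm : StrictMono w := by
    cases n with
    | zero => intro a; exact a.elim0
    | succ n =>
      rw [Fin.strictMono_iff_lt_succ]
      intro i
      apply lt_of_le_of_ne
      · exact hc i.1 (by omega)
      · simp [Fin.ext_iff]
  ext i
  have : (hm.orderIsoOfSurjective _ w.surjective) = OrderIso.refl (Fin n) := Subsingleton.elim _ _
  have h2 := congrArg (fun e => e i) this
  simp at h2
  simp [h2]

lemma exists_word {n : ℕ} (w : Perm (Fin n)) :
    ∃ l : List (Perm (Fin n)), IsAdjWord n l ∧ l.prod = w ∧ 2 * l.length + K0 w = n * n := by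
  induction hN : n * n - K0 w using Nat.strong_induction_on generalizing w with
  | _ N ih =>
    by_cases hw : w = 1
    · subst hw
      exact ⟨[], by simp [IsAdjWord], rfl, by simp [K0_one]⟩
    · obtain ⟨k, h, hk⟩ := exists_descent w hw
      have h1 := K0_adj' w k h hk
      have h2 := K0_le (w * swap ⟨k, by omega⟩ ⟨k+1, h⟩)
      obtain ⟨l, hl, hp, hlen⟩ := ih _ (by omega) (w * swap ⟨k, by omega⟩ ⟨k+1, h⟩) rfl
      refine ⟨l ++ [swap ⟨k, by omega⟩ ⟨k+1, h⟩], ?_, ?_, ?_⟩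
      · intro x hx
        simp at hx
        rcases hx with hx | hx
        · exact hl x hx
        · exact ⟨k, h, hx⟩
      · simp [hp, mul_assoc]
      · simp; omega

lemma permLength_eq {n : ℕ} (w : Perm (Fin n)) : 2 * permLength n w + K0 w = n * n := by
  obtain ⟨l, hl, hp, hlen⟩ := exists_word w
  have h1 : permLength n w ≤ l.length := Nat.sInf_le ⟨l, hl, rfl, hp⟩
  have hne : {k | ∃ l : List (Equiv.Perm (Fin n)), IsAdjWord n l ∧ l.length = k ∧ l.prod = w}.Nonempty :=
    ⟨_, l, hl, rfl, hp⟩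
  obtain ⟨l2, hl2, hlen2, hp2⟩ := Nat.sInf_mem hne
  change l2.length = permLength n w at hlen2
  have := K0_word l2 hl2
  rw [hp2] at this
  omega

lemma exists_reduced {n : ℕ} (w : Perm (Fin n)) :
    ∃ l : List (Perm (Fin n)), IsAdjWord n l ∧ l.prod = w ∧ l.length = permLength n w := by
  obtain ⟨l, hl, hp, hlen⟩ := exists_word w
  have := permLength_eq w
  exact ⟨l, hl, hp, by omega⟩

lemma K0_rev {n : ℕ} (w : Perm (Fin n)) : K0 (w * Fin.revPerm) + K0 w = n * n + n := by
  unfold K0 KK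
  have h : ∑ a : Fin n, ∑ b : Fin n, (if (id a < id b ↔ id ((w * Fin.revPerm : Perm (Fin n)) a) < id ((w * Fin.revPerm : Perm (Fin n)) b)) then 1 else 0 : ℕ)
    = ∑ a, ∑ b, (if (b < a ↔ w a < w b) then 1 else 0 : ℕ) := by
    rw [← Equiv.sum_comp (Fin.revPerm (n := n))]
    refine Finset.sum_congr rfl fun a _ => ?_
    rw [← Equiv.sum_comp (Fin.revPerm (n := n))]
    refine Finset.sum_congr rfl fun b _ => ?_
    simp
  rw [h, ← Finset.sum_add_distrib]
  have h2 : ∀ a : Fin n, ∑ b, (if (b < a ↔ w a < w b) then 1 else 0 : ℕ) +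
      ∑ b, (if (id a < id b ↔ id (w a) < id (w b)) then 1 else 0 : ℕ) = n + 1 := by
    intro a
    rw [← Finset.sum_add_distrib]
    have : ∀ b : Fin n, (if (b < a ↔ w a < w b) then 1 else 0 : ℕ) +
       (if (id a < id b ↔ id (w a) < id (w b)) then 1 else 0 : ℕ) = 1 + if a = b then 1 else 0 := by
      intro b
      by_cases hab : a = b
      · subst hab; simp
      · have : w a ≠ w b := by simpa using hab
        rcases lt_or_gt_of_ne hab with h1 | h1 <;> rcases lt_or_gt_of_ne this with h2 | h2 <;>
          simp [h1, h2, h1.le, h2.le, h1.not_gt, h2.not_gt, hab]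
    rw [Finset.sum_congr rfl (fun b _ => this b), Finset.sum_add_distrib]
    simp
  rw [Finset.sum_congr rfl (fun a _ => h2 a)]
  simp
  ring

/-- `2ℓ(g w₀) + n = K0 g`. -/
lemma permLength_K0 {n : ℕ} (w : Perm (Fin n)) : 2 * permLength n w + n = K0 (w * Fin.revPerm) := by
  have := permLength_eq w
  have := K0_rev w
  omega

lemma K0_inv {n : ℕ} (w : Perm (Fin n)) : K0 w⁻¹ = K0 w := by
  unfold K0 KK
  rw [← Equiv.sum_comp w]
  refine Finset.sum_congr rfl fun a _ => ?_
  rw [← Equiv.sum_comp w]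
  refine Finset.sum_congr rfl fun b _ => ?_
  have e : ∀ c, w⁻¹ (w c) = c := fun c => by simp
  simp only [id, e]
  congr 1
  exact propext ⟨Iff.symm, Iff.symm⟩

lemma exchange {n : ℕ} (l : List (Perm (Fin n))) (hl : IsAdjWord n l) {i j : Fin n} (hij : i < j)
    (h : l.prod j < l.prod i) :
    ∃ l' : List (Perm (Fin n)), l'.Sublist l ∧ l'.prod = l.prod * swap i j ∧
      l'.length + 1 = l.length := by
  induction l with
  | nil => simp at h; omega
  | cons s l ih =>
    have h1 : IsAdjWord n l := fun x hx => hl x (by simp [hx])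
    obtain ⟨k, hk, hs⟩ := hl s (by simp)
    simp only [List.prod_cons, Perm.mul_apply] at h
    rcases lt_or_gt_of_ne (a := l.prod i) (b := l.prod j) (by simpa using hij.ne) with h2 | h2
    · refine ⟨l, by simp, ?_, by simp⟩
      have h3 : swap (l.prod i) (l.prod j) = s := by
        rw [hs] at h ⊢
        generalize l.prod i = I at *
        generalize l.prod j = J at *
        rw [swap_apply_def, swap_apply_def] at h
        have : I = ⟨k, by omega⟩ ∧ J = ⟨k+1, hk⟩ := by
          simp only [Fin.ext_iff, Fin.lt_def] at *
          split_ifs at h <;> simp_all <;> omega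
        rw [this.1, this.2]
      rw [List.prod_cons, ← h3, mul_assoc]
      rw [Equiv.swap_mul_eq_mul_swap]
      simp [mul_assoc, swap_comm j i]
    · obtain ⟨l', a1, a2, a3⟩ := ih h1 h2
      exact ⟨s :: l', by simpa using a1, by simp [a2, mul_assoc], by simp [a3]⟩

lemma IsAdjWord.sublist {n : ℕ} {l l' : List (Perm (Fin n))} (hl : IsAdjWord n l)
    (h : l'.Sublist l) : IsAdjWord n l' := fun x hx => hl x (h.subset hx)

lemma prune {n : ℕ} (l : List (Perm (Fin n))) (hl : IsAdjWord n l) :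
    ∃ m : List (Perm (Fin n)), m.Sublist l ∧ m.prod = l.prod ∧ m.length = permLength n l.prod := by
  induction l using List.reverseRecOn with
  | nil =>
    refine ⟨[], by simp, rfl, ?_⟩
    have := permLength_eq (1 : Perm (Fin n))
    rw [K0_one] at this
    simp; omega
  | append_singleton l s ih =>
    have h1 : IsAdjWord n l := fun x hx => hl x (by simp [hx])
    obtain ⟨m, m1, m2, m3⟩ := ih h1
    obtain ⟨k, hk, hs⟩ := hl s (by simp)
    have e1 := permLength_eq l.prod
    have e2 := permLength_eq (l ++ [s]).prod
    simp only [List.prod_append, List.prod_singleton] at *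
    rcases lt_or_gt_of_ne (a := l.prod ⟨k, by omega⟩) (b := l.prod ⟨k+1, hk⟩)
      (by simp) with h | h
    · have := K0_adj _ k hk h
      rw [← hs] at this
      exact ⟨m ++ [s], m1.append (List.Sublist.refl _), by simp [m2], by simp; omega⟩
    · have := K0_adj' _ k hk h
      rw [← hs] at this
      rw [← m2] at h
      obtain ⟨m', a1, a2, a3⟩ := exchange m (h1.sublist m1) (by simp) h
      rw [← hs, m2] at a2
      exact ⟨m', (a1.trans m1).trans (List.sublist_append_left _ _), a2, by omega⟩

/-- Right multiplication by a transposition which destroys a non-inversion. -/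
def Raise {n : ℕ} (g g' : Perm (Fin n)) : Prop :=
  ∃ i j : Fin n, i < j ∧ g i < g j ∧ g' = g * swap i j

lemma bruhat_of_raise {n : ℕ} (w w' : Perm (Fin n))
    (h : Relation.ReflTransGen Raise (w * Fin.revPerm) (w' * Fin.revPerm)) :
    permBruhatLE n w' w := by
  obtain ⟨l, hl, hp, hlen⟩ := exists_reduced w
  refine ⟨l, hl, hp, hlen, ?_⟩
  have key : ∀ g', Relation.ReflTransGen Raise (w * Fin.revPerm) g' →
      ∃ l' : List (Perm (Fin n)), l'.Sublist l ∧ l'.prod = g' * Fin.revPerm := by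
    intro g' hg
    induction hg with
    | refl => exact ⟨l, List.Sublist.refl _, by rw [hp, mul_assoc]; ext; simp⟩
    | @tail g g' _ hr ih =>
      obtain ⟨l', a1, a2⟩ := ih
      obtain ⟨i, j, hij, hg, rfl⟩ := hr
      obtain ⟨l'', b1, b2, _⟩ := exchange l' (hl.sublist a1) (i := Fin.rev j) (j := Fin.rev i)
        (by simpa using hij) (by rw [a2]; simpa using hg)
      refine ⟨l'', b1.trans a1, ?_⟩
      rw [b2, a2, mul_assoc, mul_assoc]
      congr 1
      have h1 : (Fin.revPerm : Perm (Fin n)) * swap (Fin.rev j) (Fin.rev i) =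
        swap j i * Fin.revPerm := by
        rw [Equiv.mul_swap_eq_swap_mul]; simp
      rw [h1, swap_comm]
  obtain ⟨l', a1, a2⟩ := key _ h
  obtain ⟨m, b1, b2, b3⟩ := prune l' (hl.sublist a1)
  have h3 : l'.prod = w' := by rw [a2, mul_assoc]; ext; simp
  rw [h3] at b2 b3
  exact ⟨m, b1.trans a1, b2, b3⟩

/-- rank function -/
def Rk {n : ℕ} (v : Perm (Fin n)) (i j : ℕ) : ℕ :=
  (Finset.univ.filter (fun a : Fin n => a.val < i ∧ j ≤ (v a).val)).card

lemma Rk_succ {n : ℕ} (v : Perm (Fin n)) (i j : ℕ) (hi : i < n) :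
    Rk v (i + 1) j = Rk v i j + if j ≤ (v ⟨i, hi⟩).val then 1 else 0 := by
  unfold Rk
  split_ifs with h
  · rw [← Finset.card_insert_of_notMem (a := (⟨i, hi⟩ : Fin n)) (by simp)]
    congr 1
    ext a
    simp only [Finset.mem_filter, Finset.mem_univ, true_and, Finset.mem_insert]
    constructor
    · rintro ⟨h1, h2⟩
      by_cases h3 : a = ⟨i, hi⟩
      · exact Or.inl h3
      · right; refine ⟨?_, h2⟩
        simp only [Fin.ext_iff] at h3; omega
    · rintro (rfl | ⟨h1, h2⟩)
      · exact ⟨by simp, h⟩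
      · exact ⟨by omega, h2⟩
  · rw [add_zero]
    congr 1
    ext a
    simp only [Finset.mem_filter, Finset.mem_univ, true_and]
    constructor
    · rintro ⟨h1, h2⟩
      refine ⟨?_, h2⟩
      rcases Nat.lt_succ_iff_lt_or_eq.mp h1 with h3 | h3
      · exact h3
      · exfalso; apply h
        have : a = ⟨i, hi⟩ := Fin.ext h3
        rw [← this]; exact h2
    · rintro ⟨h1, h2⟩
      exact ⟨by omega, h2⟩

lemma Rk_swap_ne {n : ℕ} (v : Perm (Fin n)) (i j k : ℕ) (hk : k + 1 < n) (hi : i ≠ k + 1) :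
    Rk (v * swap (⟨k, by omega⟩ : Fin n) ⟨k+1, hk⟩) i j = Rk v i j := by
  unfold Rk
  apply Finset.card_bij (fun a _ => swap (⟨k, by omega⟩ : Fin n) ⟨k+1, hk⟩ a)
  · intro a ha
    rw [Finset.mem_filter] at ha ⊢
    refine ⟨Finset.mem_univ _, ?_, ha.2.2⟩
    have h0 := ha.2.1
    rw [swap_apply_def]
    simp only [Fin.ext_iff]
    split_ifs <;> (try dsimp only) <;> omega
  · intro a _ b _ h
    simpa using h
  · intro b hb
    refine ⟨swap (⟨k, by omega⟩ : Fin n) ⟨k+1, hk⟩ b, ?_, by simp⟩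
    rw [Finset.mem_filter] at hb ⊢
    refine ⟨Finset.mem_univ _, ?_, by rw [Perm.mul_apply, swap_apply_self]; exact hb.2.2⟩
    have h0 := hb.2.1
    rw [swap_apply_def]
    simp only [Fin.ext_iff]
    split_ifs <;> (try dsimp only) <;> omega

lemma Rk_swap_eq {n : ℕ} (v : Perm (Fin n)) (j k : ℕ) (hk : k + 1 < n) :
    Rk (v * swap (⟨k, by omega⟩ : Fin n) ⟨k+1, hk⟩) (k+1) j =
      Rk v k j + if j ≤ (v ⟨k+1, hk⟩).val then 1 else 0 := by
  rw [Rk_succ _ _ _ (by omega), Rk_swap_ne _ _ _ _ _ (by omega)]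
  simp

lemma Rk_mono_word {n : ℕ} (l l' : List (Perm (Fin n))) (hl : IsAdjWord n l)
    (hred : 2 * l.length + K0 l.prod = n * n) (h : l'.Sublist l) (i j : ℕ) :
    Rk (l'.prod)⁻¹ i j ≤ Rk (l.prod)⁻¹ i j := by
  induction h generalizing i j with
  | slnil => exact le_rfl
  | @cons l' l s hsub ih =>
    obtain ⟨k, hk, hs⟩ := hl s (by simp)
    have h1 : IsAdjWord n l := fun x hx => hl x (by simp [hx])
    have hw := K0_word l h1
    rw [List.prod_cons, ← K0_inv, mul_inv_rev] at hred
    have hsi : s⁻¹ = s := by rw [hs]; simp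
    rw [hsi, hs] at hred
    rw [← K0_inv] at hw
    rw [List.prod_cons, mul_inv_rev, hsi, hs]
    simp only [List.length_cons] at hred
    rcases lt_or_gt_of_ne (a := (l.prod)⁻¹ ⟨k, by omega⟩) (b := (l.prod)⁻¹ ⟨k+1, hk⟩)
      (by simp) with h | h
    · have e := K0_adj _ k hk h
      refine (ih h1 (by rw [← K0_inv]; omega) i j).trans ?_
      by_cases hi : i = k + 1
      · rw [hi, Rk_swap_eq, Rk_succ _ _ _ (by omega)]
        rw [Fin.lt_def] at h
        split_ifs <;> omega
      · rw [Rk_swap_ne _ _ _ _ _ hi]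
    · have e := K0_adj' _ k hk h
      omega
  | @cons_cons l' l s hsub ih =>
    obtain ⟨k, hk, hs⟩ := hl s (by simp)
    have h1 : IsAdjWord n l := fun x hx => hl x (by simp [hx])
    have hw := K0_word l h1
    rw [List.prod_cons, ← K0_inv, mul_inv_rev] at hred
    have hsi : s⁻¹ = s := by rw [hs]; simp
    rw [hsi, hs] at hred
    rw [← K0_inv] at hw
    rw [List.prod_cons, mul_inv_rev, List.prod_cons, mul_inv_rev, hsi, hs]
    simp only [List.length_cons] at hred
    rcases lt_or_gt_of_ne (a := (l.prod)⁻¹ ⟨k, by omega⟩) (b := (l.prod)⁻¹ ⟨k+1, hk⟩)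
      (by simp) with h | h
    · have e := K0_adj _ k hk h
      have ih' := ih h1 (by rw [← K0_inv]; omega)
      by_cases hi : i = k + 1
      · rw [hi, Rk_swap_eq, Rk_swap_eq]
        have i1 := ih' k j
        have i2 := ih' (k+1+1) j
        rw [Rk_succ _ _ _ hk, Rk_succ _ _ _ (by omega), Rk_succ _ _ _ hk, Rk_succ _ _ _ (by omega)] at i2
        rw [Fin.lt_def] at h
        split_ifs at * <;> omega
      · rw [Rk_swap_ne _ _ _ _ _ hi, Rk_swap_ne _ _ _ _ _ hi]
        exact ih' i j
    · have e := K0_adj' _ k hk h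
      omega

lemma bruhat_len {n : ℕ} {x' x : Perm (Fin n)} (h : permBruhatLE n x' x) :
    permLength n x' ≤ permLength n x := by
  obtain ⟨l, _, _, h3, l', h4, _, h6⟩ := h
  rw [← h3, ← h6]; exact h4.length_le

lemma bruhat_rank {n : ℕ} {x' x : Perm (Fin n)} (h : permBruhatLE n x' x) (i j : ℕ) :
    Rk x'⁻¹ i j ≤ Rk x⁻¹ i j := by
  obtain ⟨l, h1, h2, h3, l', h4, h5, _⟩ := h
  have := Rk_mono_word l l' h1 (by rw [h2, h3, permLength_eq]) h4 i j
  rwa [h5, h2] at this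

/-- In terms of `g = w w₀`: `#{a < j, g a < i}` decreases when going from `x` to `x'`. -/
lemma bruhat_rank' {n : ℕ} {x' x : Perm (Fin n)} (h : permBruhatLE n x' x) (i j : ℕ) :
    (Finset.univ.filter (fun a : Fin n => ((x' * Fin.revPerm : Perm (Fin n)) a).val < i ∧ a.val < j)).card ≤
    (Finset.univ.filter (fun a : Fin n => ((x * Fin.revPerm : Perm (Fin n)) a).val < i ∧ a.val < j)).card := by
  have key : ∀ w : Perm (Fin n),
      (Finset.univ.filter (fun a : Fin n => ((w * Fin.revPerm : Perm (Fin n)) a).val < i ∧ a.val < j)).card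
      = Rk w⁻¹ i (n - j) := by
    intro w
    unfold Rk
    symm
    apply Finset.card_bij (fun a _ => Fin.rev (w⁻¹ a))
    · intro a ha
      simp at ha ⊢
      exact ⟨ha.1, by omega⟩
    · intro a _ b _ h; simpa using h
    · intro b hb
      refine ⟨w (Fin.rev b), ?_, by simp⟩
      simp at hb ⊢
      exact ⟨hb.1, by omega⟩
  rw [key, key]
  exact bruhat_rank h _ _

lemma ST_fourier (p Q m k : ℕ) (hp : Odd p) (hQ : Odd Q) (hpQ : p ∣ Q) (hm : p * m < Q)
    (hk : k ≤ 2 * m) (A : ℕ → ℤ) (hA : ∀ t, A (t + p) = A t) (u : ℂ)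
    (hu : u = Complex.exp (Real.pi * Complex.I * ((k : ℂ) - m) / Q)) :
    ∑ t ∈ Finset.range (2 * Q), ((-1 : ℂ) ^ t * (A t : ℂ)) * u ^ t = 0 := by
  have hQ0 : 0 < Q := hQ.pos
  have hQc : (Q : ℂ) ≠ 0 := by exact_mod_cast hQ0.ne'
  set F : ℕ → ℂ := fun t => ((-1 : ℂ) ^ t * (A t : ℂ)) * u ^ t with hF
  have hu2 : u ^ (2 * Q) = 1 := by
    rw [hu, ← Complex.exp_nat_mul, Complex.exp_eq_one_iff]
    refine ⟨(k : ℤ) - m, ?_⟩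
    push_cast
    field_simp
  have hAQ : ∀ j t, A (t + p * j) = A t := by
    intro j
    induction j with
    | zero => intro t; simp
    | succ j ih => intro t; rw [Nat.mul_succ, ← add_assoc, hA, ih]
  have hper : ∀ t, F (t + 2 * Q) = F t := by
    intro t
    obtain ⟨j, hj⟩ := hpQ
    have h1 : A (t + 2 * Q) = A t := by
      rw [hj, show 2 * (p * j) = p * (2 * j) by ring]; exact hAQ _ _
    simp only [hF, h1, pow_add, hu2, pow_mul]
    norm_num
  have hsh : ∀ t, F (t + p) = - u ^ p * F t := by
    intro t
    simp only [hF, hA, pow_add, hp.neg_one_pow]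
    ring
  have hsum : ∀ j, ∑ t ∈ Finset.range (2 * Q), F (t + j) = ∑ t ∈ Finset.range (2 * Q), F t := by
    intro j
    induction j with
    | zero => simp
    | succ j ih =>
      rw [← ih]
      have h1 := Finset.sum_range_succ (fun t => F (t + j)) (2 * Q)
      have h2 := Finset.sum_range_succ' (fun t => F (t + j)) (2 * Q)
      rw [h2] at h1
      have h3 : F (2 * Q + j) = F (0 + j) := by
        rw [add_comm (2 * Q) j, hper, zero_add]
      rw [h3] at h1
      have h4 := add_right_cancel h1
      rw [← h4]
      refine Finset.sum_congr rfl fun t _ => ?_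
      congr 1; ring
  have h1 := hsum p
  simp only [hsh, ← Finset.mul_sum] at h1
  have h2 : (1 + u ^ p) * ∑ t ∈ Finset.range (2 * Q), F t = 0 := by
    linear_combination -h1
  rcases mul_eq_zero.mp h2 with h3 | h3
  · exfalso
    have h4 : u ^ p = -1 := by linear_combination h3
    rw [← Complex.exp_pi_mul_I, hu, ← Complex.exp_nat_mul, Complex.exp_eq_exp_iff_exists_int] at h4
    obtain ⟨N, hN⟩ := h4
    have hpi : (Real.pi : ℂ) * Complex.I ≠ 0 :=
      mul_ne_zero (by exact_mod_cast Real.pi_ne_zero) Complex.I_ne_zero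
    have h5 : (p : ℂ) * ((k : ℂ) - m) = Q * (1 + 2 * N) := by
      field_simp at hN
      have : (Real.pi : ℂ) ≠ 0 := by exact_mod_cast Real.pi_ne_zero
      apply mul_left_cancel₀ hpi
      linear_combination Complex.I * Real.pi * hN
    have h6 : (p : ℤ) * ((k : ℤ) - m) = Q * (1 + 2 * N) := by exact_mod_cast h5
    have h7 : |(p : ℤ) * ((k : ℤ) - m)| < Q := by
      rw [abs_mul, abs_of_nonneg (by positivity : (0 : ℤ) ≤ p)]
      have : |(k : ℤ) - m| ≤ m := by rw [abs_le]; omega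
      have h8 : (p : ℤ) * |(k : ℤ) - m| ≤ p * m := by gcongr
      have : ((p * m : ℕ) : ℤ) < Q := by exact_mod_cast hm
      push_cast at this
      omega
    rw [h6, abs_mul, abs_of_nonneg (by positivity : (0 : ℤ) ≤ Q)] at h7
    have h9 : 1 ≤ |1 + 2 * N| := by
      rw [← Int.not_lt, Int.abs_lt_one_iff]; omega
    nlinarith
  · exact h3

lemma sin_prod_poly (Q : ℕ) (hQ : 0 < Q) (Z : Finset ℕ) :
    ∃ R : Polynomial ℂ, R.natDegree ≤ Z.card ∧ ∀ t : ℕ,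
      ((∏ z ∈ Z, Real.sin (((t : ℝ) - z - 1 / 2) * (Real.pi / (2 * Q))) : ℝ) : ℂ) =
      Complex.exp (-(Real.pi * Complex.I * t / (2 * Q))) ^ Z.card *
        R.eval (Complex.exp (Real.pi * Complex.I * t / Q)) := by
  classical
  have hQc : (Q : ℂ) ≠ 0 := by exact_mod_cast hQ.ne'
  induction Z using Finset.induction_on with
  | empty => exact ⟨1, by simp, by simp⟩
  | insert z Z hz ih =>
    obtain ⟨R, h1, h2⟩ := ih
    set α : ℂ := Complex.exp (-((z + 1 / 2) * (Real.pi / (2 * Q))) * Complex.I) * (-Complex.I / 2)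
      with hα
    set β : ℂ := Complex.exp (((z + 1 / 2) * (Real.pi / (2 * Q))) * Complex.I) * (Complex.I / 2)
      with hβ
    refine ⟨(Polynomial.C α * Polynomial.X + Polynomial.C β) * R, ?_, ?_⟩
    · rw [Finset.card_insert_of_notMem hz]
      refine (Polynomial.natDegree_mul_le).trans ?_
      have := Polynomial.natDegree_linear_le (a := α) (b := β)
      omega
    · intro t
      rw [Finset.prod_insert hz, Finset.card_insert_of_notMem hz, Complex.ofReal_mul, h2,
        Polynomial.eval_mul, pow_succ]
      have key : ((Real.sin (((t : ℝ) - z - 1 / 2) * (Real.pi / (2 * Q))) : ℝ) : ℂ) =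
          Complex.exp (-(Real.pi * Complex.I * t / (2 * Q))) *
          Polynomial.eval (Complex.exp (Real.pi * Complex.I * t / Q))
            (Polynomial.C α * Polynomial.X + Polynomial.C β) := by
        rw [Complex.ofReal_sin, Complex.sin]
        simp only [Polynomial.eval_add, Polynomial.eval_mul, Polynomial.eval_C, Polynomial.eval_X]
        rw [hα, hβ]
        push_cast
        have e1 : Complex.exp (-(((t : ℂ) - z - 1 / 2) * (Real.pi / (2 * Q))) * Complex.I) =
            Complex.exp (-(Real.pi * Complex.I * t / (2 * Q))) *
            Complex.exp (((z + 1 / 2) * (Real.pi / (2 * Q))) * Complex.I) := by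
          rw [← Complex.exp_add]; congr 1; field_simp; ring
        have e2 : Complex.exp ((((t : ℂ) - z - 1 / 2) * (Real.pi / (2 * Q))) * Complex.I) =
            Complex.exp (-(Real.pi * Complex.I * t / (2 * Q))) *
            Complex.exp (-((z + 1 / 2) * (Real.pi / (2 * Q))) * Complex.I) *
            Complex.exp (Real.pi * Complex.I * t / Q) := by
          rw [← Complex.exp_add, ← Complex.exp_add]; congr 1; field_simp; ring
        rw [e1, e2]
        ring
      rw [key]
      ring

lemma ST_core (p q Q m : ℕ) (hp : Odd p) (hq : Odd q) (hQ : Odd Q) (hpQ : p ∣ Q) (hqQ : q ∣ Q)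
    (hqp : q ≤ p) (hm : p * m < Q) (A B : ℕ → ℤ) (hA : ∀ t, A (t + p) = A t)
    (hB : ∀ t, B (t + q) = B t) (Z : Finset ℕ) (hZ : Z.card = 2 * m) :
    ∑ t ∈ Finset.range (2 * Q), ((-1 : ℝ) ^ t * ((A t : ℝ) - B t)) *
      ∏ z ∈ Z, Real.sin (((t : ℝ) - z - 1 / 2) * (Real.pi / (2 * Q))) = 0 := by
  have hQ0 : 0 < Q := hQ.pos
  have hQc : (Q : ℂ) ≠ 0 := by exact_mod_cast hQ0.ne'
  obtain ⟨R, h1, h2⟩ := sin_prod_poly Q hQ0 Z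
  rw [hZ] at h1 h2
  have : ∀ t : ℕ, Complex.exp (-(Real.pi * Complex.I * t / (2 * Q))) ^ (2 * m) *
        R.eval (Complex.exp (Real.pi * Complex.I * t / Q)) =
      ∑ k ∈ Finset.range (2 * m + 1), R.coeff k *
        (Complex.exp (Real.pi * Complex.I * ((k : ℂ) - m) / Q)) ^ t := by
    intro t
    rw [Polynomial.eval_eq_sum_range' (Nat.lt_succ_of_le h1), Finset.mul_sum]
    refine Finset.sum_congr rfl fun k _ => ?_
    have : Complex.exp (-(Real.pi * Complex.I * t / (2 * Q))) ^ (2 * m) *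
       Complex.exp (Real.pi * Complex.I * t / Q) ^ k =
       (Complex.exp (Real.pi * Complex.I * ((k : ℂ) - m) / Q)) ^ t := by
      rw [← Complex.exp_nat_mul, ← Complex.exp_nat_mul, ← Complex.exp_nat_mul, ← Complex.exp_add]
      congr 1; push_cast; field_simp; ring
    rw [← this]; ring
  have hc : ((∑ t ∈ Finset.range (2 * Q), ((-1 : ℝ) ^ t * ((A t : ℝ) - B t)) *
      ∏ z ∈ Z, Real.sin (((t : ℝ) - z - 1 / 2) * (Real.pi / (2 * Q))) : ℝ) : ℂ) = 0 := by
    rw [Complex.ofReal_sum]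
    simp only [Complex.ofReal_mul (_ * _), h2, this]
    simp only [Finset.mul_sum]
    rw [Finset.sum_comm]
    apply Finset.sum_eq_zero
    intro k hk
    have hk' : k ≤ 2 * m := by simpa [Nat.lt_succ_iff] using hk
    have ea := ST_fourier p Q m k hp hQ hpQ hm hk' A hA _ rfl
    have eb := ST_fourier q Q m k hq hQ hqQ (by nlinarith) hk' B hB _ rfl
    have : ∀ t : ℕ, ((((-1 : ℝ) ^ t * ((A t : ℝ) - B t) : ℝ)) : ℂ) * (R.coeff k *
        (Complex.exp (Real.pi * Complex.I * ((k : ℂ) - m) / Q)) ^ t) =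
        R.coeff k * (((-1 : ℂ) ^ t * (A t : ℂ)) *
          (Complex.exp (Real.pi * Complex.I * ((k : ℂ) - m) / Q)) ^ t) -
        R.coeff k * (((-1 : ℂ) ^ t * (B t : ℂ)) *
          (Complex.exp (Real.pi * Complex.I * ((k : ℂ) - m) / Q)) ^ t) := by
      intro t; push_cast; ring
    simp only [this, Finset.sum_sub_distrib, ← Finset.mul_sum, ea, eb]
    simp
  exact_mod_cast hc

lemma sin_sign (Q t z : ℕ) (hQ : 0 < Q) (ht : t < 2 * Q) (hz : z < 2 * Q) :
    (z < t → 0 < Real.sin (((t : ℝ) - z - 1 / 2) * (Real.pi / (2 * Q)))) ∧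
    (t ≤ z → Real.sin (((t : ℝ) - z - 1 / 2) * (Real.pi / (2 * Q))) < 0) := by
  have hQr : (0 : ℝ) < Q := by exact_mod_cast hQ
  have h0 : 0 < Real.pi / (2 * Q) := by positivity
  have e : Real.pi = 2 * Q * (Real.pi / (2 * Q)) := by field_simp
  set δ := Real.pi / (2 * Q)
  have ht' : (t : ℝ) + 1 ≤ 2 * Q := by exact_mod_cast ht
  have hz' : (z : ℝ) + 1 ≤ 2 * Q := by exact_mod_cast hz
  have ht0 : (0 : ℝ) ≤ t := by positivity
  have hz0 : (0 : ℝ) ≤ z := by positivity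
  constructor
  · intro h
    have h' : (z : ℝ) + 1 ≤ t := by exact_mod_cast h
    apply Real.sin_pos_of_pos_of_lt_pi
    · apply mul_pos _ h0; linarith
    · conv_rhs => rw [e]
      apply mul_lt_mul_of_pos_right _ h0; linarith
  · intro h
    have h' : (t : ℝ) ≤ z := by exact_mod_cast h
    apply Real.sin_neg_of_neg_of_neg_pi_lt
    · apply mul_neg_of_neg_of_pos _ h0; linarith
    · conv_lhs => rw [e, ← neg_mul]
      apply mul_lt_mul_of_pos_right _ h0; linarith

lemma sturmST (p q Q : ℕ) (hp : Odd p) (hq : Odd q) (hQ : Odd Q) (hpQ : p ∣ Q) (hqQ : q ∣ Q)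
    (hqp : q ≤ p) (A B : ℕ → ℤ) (hA : ∀ t, A (t + p) = A t)
    (hB : ∀ t, B (t + q) = B t) (hAB : ∀ t, A t ≠ B t) :
    Q ≤ p * ((Finset.range Q).filter (fun t => A t < B t ↔ A (t + 1) < B (t + 1))).card := by
  classical
  by_contra hcon
  push Not at hcon
  set m := ((Finset.range Q).filter (fun t => A t < B t ↔ A (t + 1) < B (t + 1))).card with hm
  set Z := (Finset.range (2 * Q)).filter (fun t => A t < B t ↔ A (t + 1) < B (t + 1)) with hZ
  have per : ∀ (p : ℕ) (A : ℕ → ℤ), (∀ t, A (t + p) = A t) → p ∣ Q → ∀ t, A (t + Q) = A t := by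
    intro p A hA hpQ
    obtain ⟨j, rfl⟩ := hpQ
    clear * - hA
    induction j with
    | zero => intro t; simp
    | succ j ih => intro t; rw [Nat.mul_succ, ← add_assoc, hA, ih]
  have hAQ := per p A hA hpQ
  have hBQ := per q B hB hqQ
  have hQ0 : 0 < Q := hQ.pos
  have hZc : Z.card = 2 * m := by
    rw [hZ, hm, Finset.card_filter, Finset.card_filter, two_mul, two_mul, Finset.sum_range_add]
    congr 1
    refine Finset.sum_congr rfl fun t _ => ?_
    rw [show Q + t = t + Q by ring, hAQ, hBQ, show t + Q + 1 = t + 1 + Q by ring, hAQ, hBQ]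
  have h0 := ST_core p q Q m hp hq hQ hpQ hqQ hqp hcon A B hA hB Z hZc
  set f : ℕ → ℝ := fun t => (-1 : ℝ) ^ t * ((A t : ℝ) - B t) with hf
  set P : ℕ → ℝ := fun t => ∏ z ∈ Z, Real.sin (((t : ℝ) - z - 1 / 2) * (Real.pi / (2 * Q))) with hP
  have hZlt : ∀ z ∈ Z, z < 2 * Q := by
    intro z hz; rw [hZ, Finset.mem_filter] at hz; simpa using hz.1
  have step : ∀ t, t + 1 < 2 * Q → 0 < (f t * P t) * (f (t + 1) * P (t + 1)) := by
    intro t ht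
    have hff : f t * f (t + 1) = - (((A t : ℝ) - B t) * ((A (t + 1) : ℝ) - B (t + 1))) := by
      simp only [hf, pow_succ]
      have : ((-1 : ℝ) ^ t) * ((-1 : ℝ) ^ t) = 1 := by rw [← mul_pow]; simp
      linear_combination (-(((A t : ℝ) - B t) * ((A (t + 1) : ℝ) - B (t + 1)))) * this
    have hpos : ∀ z ∈ Z, z ≠ t → 0 < Real.sin (((t : ℝ) - z - 1 / 2) * (Real.pi / (2 * Q))) *
        Real.sin ((((t + 1 : ℕ) : ℝ) - z - 1 / 2) * (Real.pi / (2 * Q))) := by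
      intro z hz hzt
      have s1 := sin_sign Q t z hQ0 (by omega) (hZlt z hz)
      have s2 := sin_sign Q (t + 1) z hQ0 (by omega) (hZlt z hz)
      rcases lt_or_gt_of_ne hzt with h | h
      · exact mul_pos (s1.1 h) (s2.1 (by omega))
      · exact mul_pos_of_neg_of_neg (s1.2 h.le) (s2.2 h)
    have hAt := hAB t
    have hAt1 := hAB (t + 1)
    rw [show (f t * P t) * (f (t + 1) * P (t + 1)) = (f t * f (t + 1)) * (P t * P (t + 1)) by ring,
      hff]
    have hPP : P t * P (t + 1) = ∏ z ∈ Z, (Real.sin (((t : ℝ) - z - 1 / 2) * (Real.pi / (2 * Q))) *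
        Real.sin ((((t + 1 : ℕ) : ℝ) - z - 1 / 2) * (Real.pi / (2 * Q)))) := by
      simp only [hP]; rw [Finset.prod_mul_distrib]
    rw [hPP]
    have r1 : A t < B t → (A t : ℝ) - B t < 0 := fun h => by
      have : (A t : ℝ) < B t := by exact_mod_cast h
      linarith
    have r2 : B t < A t → 0 < (A t : ℝ) - B t := fun h => by
      have : (B t : ℝ) < A t := by exact_mod_cast h
      linarith
    have r3 : A (t + 1) < B (t + 1) → (A (t + 1) : ℝ) - B (t + 1) < 0 := fun h => by
      have : (A (t + 1) : ℝ) < B (t + 1) := by exact_mod_cast h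
      linarith
    have r4 : B (t + 1) < A (t + 1) → 0 < (A (t + 1) : ℝ) - B (t + 1) := fun h => by
      have : (B (t + 1) : ℝ) < A (t + 1) := by exact_mod_cast h
      linarith
    by_cases htZ : t ∈ Z
    · have hnc := htZ
      rw [hZ, Finset.mem_filter] at hnc
      have hnc := hnc.2
      rw [← Finset.mul_prod_erase _ _ htZ]
      have e1 : 0 < ∏ z ∈ Z.erase t, (Real.sin (((t : ℝ) - z - 1 / 2) * (Real.pi / (2 * Q))) *
        Real.sin ((((t + 1 : ℕ) : ℝ) - z - 1 / 2) * (Real.pi / (2 * Q)))) := by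
        apply Finset.prod_pos
        intro z hz
        rw [Finset.mem_erase] at hz
        exact hpos z hz.2 hz.1
      have s1 := (sin_sign Q t t hQ0 (by omega) (hZlt t htZ)).2 le_rfl
      have s2 := (sin_sign Q (t + 1) t hQ0 (by omega) (hZlt t htZ)).1 (by omega)
      have e2 := mul_neg_of_neg_of_pos s1 s2
      have e3 := mul_neg_of_neg_of_pos e2 e1
      apply mul_pos_of_neg_of_neg _ e3
      rw [neg_lt_zero]
      rcases lt_or_gt_of_ne hAt with h | h
      · exact mul_pos_of_neg_of_neg (r1 h) (r3 (hnc.mp h))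
      · apply mul_pos (r2 h) (r4 _)
        have : ¬ A (t + 1) < B (t + 1) := fun h' => absurd (hnc.mpr h') (by omega)
        omega
    · have hnc : ¬ (A t < B t ↔ A (t + 1) < B (t + 1)) := by
        intro h; apply htZ; rw [hZ, Finset.mem_filter]; exact ⟨by simp; omega, h⟩
      have e1 : 0 < ∏ z ∈ Z, (Real.sin (((t : ℝ) - z - 1 / 2) * (Real.pi / (2 * Q))) *
        Real.sin ((((t + 1 : ℕ) : ℝ) - z - 1 / 2) * (Real.pi / (2 * Q)))) := by
        apply Finset.prod_pos
        intro z hz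
        exact hpos z hz (fun h => htZ (h ▸ hz))
      apply mul_pos _ e1
      rw [neg_pos]
      rcases lt_or_gt_of_ne hAt with h | h
      · apply mul_neg_of_neg_of_pos (r1 h) (r4 _)
        have : ¬ A (t + 1) < B (t + 1) := fun h' => hnc ⟨fun _ => h', fun _ => h⟩
        omega
      · apply mul_neg_of_pos_of_neg (r2 h) (r3 _)
        by_contra h'
        exact hnc ⟨fun h'' => absurd h'' (by omega), fun h'' => absurd h'' h'⟩
  have all : ∀ t, t < 2 * Q → 0 < (f 0 * P 0) * (f t * P t) := by
    intro t
    induction t with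
    | zero =>
      intro _
      have := step 0 (by omega)
      have h1 : f 0 * P 0 ≠ 0 := fun h => by rw [h] at this; simp at this
      exact mul_self_pos.mpr h1
    | succ t ih =>
      intro ht
      have i1 := ih (by omega)
      have i2 := step t ht
      have i3 := mul_pos i1 i2
      have e : f 0 * P 0 * (f t * P t) * (f t * P t * (f (t + 1) * P (t + 1))) =
        (f t * P t) ^ 2 * (f 0 * P 0 * (f (t + 1) * P (t + 1))) := by ring
      rw [e] at i3
      exact (pos_iff_pos_of_mul_pos i3).mp (by
        have h1 : f t * P t ≠ 0 := fun h => by rw [h] at i1; simp at i1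
        positivity)
  have : 0 < ∑ t ∈ Finset.range (2 * Q), (f 0 * P 0) * (f t * P t) := by
    apply Finset.sum_pos
    · intro t ht; exact all t (by simpa using ht)
    · exact ⟨0, by simp; omega⟩
  rw [← Finset.mul_sum] at this
  rw [h0] at this
  simp at this

lemma par_exists (ε : ℕ → Prop) (p : ℕ) (hp : Odd p) (h : ∀ s, ε (s + p) ↔ ε s) :
    ∃ s < p, (ε s ↔ ε (s + 1)) := by
  by_contra hcon
  push Not at hcon
  have key : ∀ s, s ≤ p → ((ε s ↔ ε 0) ↔ Even s) := by
    intro s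
    induction s with
    | zero => simp
    | succ s ih =>
      intro hs
      have i1 := ih (by omega)
      have i2 := hcon s (by omega)
      rw [Nat.even_add_one, ← i1]
      by_cases ε s <;> by_cases ε (s+1) <;> by_cases ε 0 <;> simp_all
  have := (key p le_rfl).mp (by simpa using h 0)
  exact absurd hp (by simpa using this)

lemma two_nc (a : ℕ → ℤ) (p d : ℕ) (hp : Even p) (hd : Even d) (hp0 : 0 < p)
    (ha : ∀ s, a (s + p) = a s) (hne : ∀ s, a s ≠ a (s + d)) :
    2 ≤ ((Finset.range p).filter (fun s => a s < a (s + d) ↔ a (s + 1) < a (s + 1 + d))).card := by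
  classical
  by_contra hcon
  have hle : ((Finset.range p).filter
    (fun s => a s < a (s + d) ↔ a (s + 1) < a (s + 1 + d))).card ≤ 1 := by omega
  rw [Finset.card_le_one] at hle
  have hs0 : ∃ s0 < p, ∀ s < p, s ≠ s0 → ¬ (a s < a (s + d) ↔ a (s + 1) < a (s + 1 + d)) := by
    by_cases h : ∃ s0 < p, (a s0 < a (s0 + d) ↔ a (s0 + 1) < a (s0 + 1 + d))
    · obtain ⟨s0, h1, h2⟩ := h
      refine ⟨s0, h1, fun s hs hne h3 => hne ?_⟩
      exact hle s (by simp only [Finset.mem_filter, Finset.mem_range]; exact ⟨hs, h3⟩)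
        s0 (by simp only [Finset.mem_filter, Finset.mem_range]; exact ⟨h1, h2⟩)
    · push Not at h
      refine ⟨0, hp0, fun s hs _ h3 => ?_⟩
      rcases h s hs with h | h <;> omega
  obtain ⟨s0, hs0, hch⟩ := hs0
  set h : ℕ → ℤ := fun s => (-1) ^ s * (a s - a (s + d)) with hh
  have hper : ∀ s, h (s + p) = h s := by
    intro s
    simp only [hh, ha, pow_add, hp.neg_one_pow, show s + p + d = s + d + p by ring]
    ring
  have hsum : ∀ (u : ℕ → ℤ), (∀ s, u (s + p) = u s) → ∀ j, ∑ s ∈ Finset.range p, u (s + j) =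
      ∑ s ∈ Finset.range p, u s := by
    intro u hu j
    induction j with
    | zero => simp
    | succ j ih =>
      rw [← ih]
      have h1 := Finset.sum_range_succ (fun t => u (t + j)) p
      have h2 := Finset.sum_range_succ' (fun t => u (t + j)) p
      rw [h2] at h1
      have h3 : u (p + j) = u (0 + j) := by
        rw [add_comm p j, hu, zero_add]
      rw [h3] at h1
      have h4 := add_right_cancel h1
      rw [← h4]
      refine Finset.sum_congr rfl fun t _ => ?_
      congr 1; ring
  have hz : ∑ s ∈ Finset.range p, h s = 0 := by
    have := hsum (fun s => (-1) ^ s * a s) (fun s => by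
      simp only [ha, pow_add, hp.neg_one_pow, mul_one]) d
    simp only [hh, mul_sub, Finset.sum_sub_distrib]
    rw [← this, sub_eq_zero]
    refine Finset.sum_congr rfl fun s _ => ?_
    rw [pow_add, hd.neg_one_pow, mul_one]
  have step : ∀ s, s % p ≠ s0 → 0 < h s * h (s + 1) := by
    intro s hs
    have per : ∀ k, h (s % p + p * k) = h (s % p) ∧ h (s % p + 1 + p * k) = h (s % p + 1) := by
      intro k
      induction k with
      | zero => simp
      | succ k ih =>
        rw [Nat.mul_succ, ← add_assoc, ← add_assoc, hper, hper]
        exact ih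
    have e := per (s / p)
    rw [show s % p + 1 + p * (s / p) = (s % p + p * (s / p)) + 1 by ring, Nat.mod_add_div] at e
    rw [e.1, e.2]
    have hc := hch (s % p) (Nat.mod_lt _ hp0) hs
    generalize s % p = r at *
    have n1 := hne r
    have n2 := hne (r + 1)
    simp only [hh, pow_succ]
    have : ((-1 : ℤ) ^ r) * ((-1) ^ r) = 1 := by rw [← mul_pow]; simp
    have e2 : (-1 : ℤ) ^ r * (a r - a (r + d)) * ((-1) ^ r * -1 * (a (r + 1) - a (r + 1 + d)))
      = - ((a r - a (r + d)) * (a (r + 1) - a (r + 1 + d))) := by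
      linear_combination (-((a r - a (r + d)) * (a (r + 1) - a (r + 1 + d)))) * this
    rw [e2, neg_pos]
    rcases lt_or_gt_of_ne n1 with q | q
    · have : ¬ a (r + 1) < a (r + 1 + d) := fun h' => hc ⟨fun _ => h', fun _ => q⟩
      exact mul_neg_of_neg_of_pos (by omega) (by omega)
    · have : a (r + 1) < a (r + 1 + d) := by
        by_contra h'
        exact hc ⟨fun h'' => absurd h'' (by omega), fun h'' => absurd h'' h'⟩
      exact mul_neg_of_pos_of_neg (by omega) (by omega)
  have all : ∀ j, j < p → 0 < h (s0 + 1) * h (s0 + 1 + j) := by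
    intro j
    induction j with
    | zero =>
      intro _
      rw [add_zero]
      apply mul_self_pos.mpr
      simp only [hh]
      apply mul_ne_zero (pow_ne_zero _ (by norm_num))
      have := hne (s0 + 1)
      omega
    | succ j ih =>
      intro hj
      have i1 := ih (by omega)
      have i2 := step (s0 + 1 + j) (by
        intro h'
        by_cases hlt : s0 + 1 + j < p
        · rw [Nat.mod_eq_of_lt hlt] at h'; omega
        · rw [Nat.mod_eq_sub_mod (by omega), Nat.mod_eq_of_lt (by omega)] at h'; omega)
      have i3 := mul_pos i1 i2
      have e : h (s0 + 1) * h (s0 + 1 + j) * (h (s0 + 1 + j) * h (s0 + 1 + j + 1)) =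
        (h (s0 + 1 + j)) ^ 2 * (h (s0 + 1) * h (s0 + 1 + j + 1)) := by ring
      rw [e] at i3
      have h1 : h (s0 + 1 + j) ≠ 0 := fun h => by rw [h] at i1; simp at i1
      exact (pos_iff_pos_of_mul_pos i3).mp (by positivity)
  have : 0 < ∑ j ∈ Finset.range p, h (s0 + 1) * h (j + (s0 + 1)) := by
    apply Finset.sum_pos
    · intro t ht; rw [add_comm t]; exact all t (by simpa using ht)
    · exact ⟨0, by simp; omega⟩
  rw [← Finset.mul_sum, hsum h hper, hz] at this
  simp at this

/-- non-change indicator -/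
def nc {n : ℕ} (g : Perm (Fin n)) (f : Fin n → ℤ) (a b : Fin n) : ℕ :=
  if (f a < f b ↔ f (g a) < f (g b)) then 1 else 0

lemma KK_nc {n : ℕ} (g : Perm (Fin n)) (f : Fin n → ℤ) : KK g f = ∑ a, ∑ b, nc g f a b := rfl

lemma nc_symm {n : ℕ} (g : Perm (Fin n)) (f : Fin n → ℤ) (hf : Function.Injective f) (a b : Fin n) :
    nc g f a b = nc g f b a := by
  unfold nc
  rcases eq_or_ne a b with rfl | hab
  · rfl
  have h1 : f a ≠ f b := fun h => hab (hf h)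
  have h2 : f (g a) ≠ f (g b) := fun h => hab (g.injective (hf h))
  congr 1
  apply propext
  constructor <;> intro h <;> constructor <;> intro h' <;> by_contra h'' <;> omega

/-- a cycle, parametrized. -/
structure Cyc {n : ℕ} (g : Perm (Fin n)) (c : ℕ → Fin n) (p : ℕ) : Prop where
  succ : ∀ t, c (t + 1) = g (c t)
  per : ∀ t, c (t + p) = c t
  inj : ∀ s t, s < p → t < p → c s = c t → s = t
  pos : 0 < p

lemma cyc_of {n : ℕ} (g : Perm (Fin n)) (x : Fin n) :
    Cyc g (fun t => (g ^ t) x) (Function.minimalPeriod g x) where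
  succ t := by simp [pow_succ']
  per t := by
    simp only [← Perm.iterate_eq_pow, Function.iterate_add_apply, Function.iterate_minimalPeriod]
  inj s t hs ht h := by
    simp only [← Perm.iterate_eq_pow] at h
    exact Function.iterate_injOn_Iio_minimalPeriod hs ht h
  pos := Function.minimalPeriod_pos_of_mem_periodicPts (g.injective.mem_periodicPts x)

namespace Cyc
variable {n : ℕ} {g : Perm (Fin n)} {c : ℕ → Fin n} {p : ℕ}

lemma mod (h : Cyc g c p) (t : ℕ) : c t = c (t % p) := by
  conv_lhs => rw [← Nat.mod_add_div t p]
  generalize t % p = r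
  generalize t / p = k
  induction k with
  | zero => simp
  | succ k ih => rw [Nat.mul_succ, ← add_assoc, h.per, ih]

lemma inj_mod (h : Cyc g c p) {s t : ℕ} (he : c s = c t) : s % p = t % p := by
  rw [h.mod s, h.mod t] at he
  exact h.inj _ _ (Nat.mod_lt _ h.pos) (Nat.mod_lt _ h.pos) he

lemma sum_image (h : Cyc g c p) {M : Type*} [AddCommMonoid M] (u : Fin n → M) :
    ∑ a ∈ (Finset.range p).image c, u a = ∑ s ∈ Finset.range p, u (c s) :=
  Finset.sum_image fun s hs t ht he => h.inj s t (by simpa using hs) (by simpa using ht) he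

lemma mem (h : Cyc g c p) (t : ℕ) : c t ∈ (Finset.range p).image c := by
  rw [h.mod]
  exact Finset.mem_image_of_mem _ (by simpa using Nat.mod_lt _ h.pos)

lemma mem_iff (h : Cyc g c p) (y : Fin n) :
    g y ∈ (Finset.range p).image c ↔ y ∈ (Finset.range p).image c := by
  constructor
  · intro hy
    obtain ⟨t, ht, e⟩ := Finset.mem_image.mp hy
    have : c (t + p) = c ((t + p - 1) + 1) := by congr 1; have := h.pos; omega
    rw [h.per, h.succ, e] at this
    rw [g.injective this]
    exact h.mem _
  · intro hy
    obtain ⟨t, ht, rfl⟩ := Finset.mem_image.mp hy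
    rw [← h.succ]; exact h.mem _

lemma shift (h : Cyc g c p) {M : Type*} [AddCancelCommMonoid M] (u : Fin n → M) (j : ℕ) :
    ∑ s ∈ Finset.range p, u (c (s + j)) = ∑ s ∈ Finset.range p, u (c s) := by
  induction j with
  | zero => simp
  | succ j ih =>
    rw [← ih]
    have h1 := Finset.sum_range_succ (fun t => u (c (t + j))) p
    have h2 := Finset.sum_range_succ' (fun t => u (c (t + j))) p
    rw [h2] at h1
    have h3 : u (c (p + j)) = u (c (0 + j)) := by
      rw [add_comm p j, h.per, zero_add]
    rw [h3] at h1
    have h4 := add_right_cancel h1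
    rw [← h4]
    refine Finset.sum_congr rfl fun t _ => ?_
    congr 2; ring

/-- lower bound within a cycle -/
lemma self_lower (h : Cyc g c p) (f : Fin n → ℤ) (hf : Function.Injective f) :
    p + 2 * ((p - 1) / 2) ≤ ∑ s ∈ Finset.range p, ∑ t ∈ Finset.range p, nc g f (c s) (c t) := by
  have hp0 := h.pos
  have e1 : ∑ s ∈ Finset.range p, ∑ t ∈ Finset.range p, nc g f (c s) (c t) =
      ∑ d ∈ Finset.range p, ∑ s ∈ Finset.range p, nc g f (c s) (c (s + d)) := by
    rw [Finset.sum_comm (s := Finset.range p) (t := Finset.range p)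
      (f := fun d s => nc g f (c s) (c (s + d)))]
    refine Finset.sum_congr rfl fun s _ => ?_
    rw [← h.shift _ s]
    refine Finset.sum_congr rfl fun t _ => ?_
    rw [add_comm]
  rw [e1]
  obtain ⟨q, rfl⟩ : ∃ q, p = q + 1 := ⟨p - 1, by omega⟩
  rw [Finset.sum_range_succ']
  have e2 : ∑ s ∈ Finset.range (q + 1), nc g f (c s) (c (s + 0)) = q + 1 := by
    simp [nc]
  rw [e2]
  have hne : ∀ d, 0 < d → d < q + 1 → ∀ s, c s ≠ c (s + d) := by
    intro d h0 h1 s he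
    have := h.inj_mod he
    have h2 : (s + 0) % (q + 1) = (s + d) % (q + 1) := this
    have h3 : 0 ≡ d [MOD (q + 1)] := Nat.ModEq.add_left_cancel' s h2
    have h4 : 0 % (q + 1) = d % (q + 1) := h3
    rw [Nat.mod_eq_of_lt h1] at h4
    simp at h4; omega
  suffices 2 * (q / 2) ≤ ∑ d ∈ Finset.range q, ∑ s ∈ Finset.range (q + 1),
      nc g f (c s) (c (s + (d + 1))) by
    simp only [Nat.add_sub_cancel]; omega
  have hcard : ∀ d, ∑ s ∈ Finset.range (q + 1), nc g f (c s) (c (s + d)) =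
      ((Finset.range (q + 1)).filter (fun s => f (c s) < f (c (s + d)) ↔
        f (c (s + 1)) < f (c (s + 1 + d)))).card := by
    intro d
    rw [Finset.card_filter]
    refine Finset.sum_congr rfl fun s _ => ?_
    unfold nc
    rw [h.succ, show s + 1 + d = s + d + 1 by ring, h.succ]
  rcases Nat.even_or_odd (q + 1) with hp | hp
  · -- even
    have hb : ∀ d ∈ Finset.range q, (if Odd d then 2 else 0) ≤
        ∑ s ∈ Finset.range (q + 1), nc g f (c s) (c (s + (d + 1))) := by
      intro d hd
      have hd := Finset.mem_range.mp hd
      split_ifs with hod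
      · rw [hcard]
        exact two_nc (fun t => f (c t)) (q + 1) (d + 1) hp hod.add_one hp0
          (fun s => by rw [h.per]) (fun s he => hne (d + 1) (by omega) (by omega) s (hf he))
      · exact Nat.zero_le _
    refine le_trans ?_ (Finset.sum_le_sum hb)
    clear * -
    induction q with
    | zero => simp
    | succ q ih =>
      rw [Finset.sum_range_succ]
      split_ifs with h
      · omega
      · have := Nat.not_odd_iff_even.mp h
        obtain ⟨r, rfl⟩ := this
        omega
  · have hb : ∀ d ∈ Finset.range q, 1 ≤
        ∑ s ∈ Finset.range (q + 1), nc g f (c s) (c (s + (d + 1))) := by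
      intro d hd
      have hd := Finset.mem_range.mp hd
      rw [hcard, Nat.one_le_iff_ne_zero, ← Nat.pos_iff_ne_zero, Finset.card_pos]
      obtain ⟨s, h1, h2⟩ := par_exists (fun s => f (c s) < f (c (s + (d + 1)))) (q + 1) hp
        (fun s => by rw [h.per, show s + (q + 1) + (d + 1) = s + (d + 1) + (q + 1) by ring, h.per])
      exact ⟨s, by simp only [Finset.mem_filter, Finset.mem_range]; exact ⟨h1, h2⟩⟩
    have := Finset.sum_le_sum hb
    simp at this
    simp only [← add_assoc] at this ⊢
    omega

end Cyc

lemma count_odd_range (q : ℕ) :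
    ∑ s ∈ Finset.range q, (if Odd s then 1 else 0) = q / 2 := by
  induction q with
  | zero => simp
  | succ q ih =>
    rw [Finset.sum_range_succ, ih]
    split_ifs with h
    · obtain ⟨r, rfl⟩ := h; omega
    · obtain ⟨r, rfl⟩ := Nat.not_odd_iff_even.mp h; omega

/-- alternating label -/
def altL (B : ℤ) (t : ℕ) : ℤ := (-1) ^ (t + 1) * (B - t)

lemma altL_even (B : ℤ) {t : ℕ} (h : Even t) : altL B t = - (B - t) := by
  unfold altL; rw [pow_succ, h.neg_one_pow]; ring
lemma altL_odd (B : ℤ) {t : ℕ} (h : Odd t) : altL B t = B - t := by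
  unfold altL; rw [pow_succ, h.neg_one_pow]; ring

lemma altL_lt (B : ℤ) {s t : ℕ} (hst : s < t) (ht : (t : ℤ) < B) :
    altL B s < altL B t ↔ Even s := by
  rcases Nat.even_or_odd s with hs | hs <;> rcases Nat.even_or_odd t with h | h
  · rw [altL_even B hs, altL_even B h]; simp [hs]; omega
  · rw [altL_even B hs, altL_odd B h]; simp [hs]; omega
  · rw [altL_odd B hs, altL_even B h]
    simp [Nat.not_even_iff_odd.mpr hs]; omega
  · rw [altL_odd B hs, altL_odd B h]
    simp [Nat.not_even_iff_odd.mpr hs]; omega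

lemma altL_lt_of_abs (B : ℤ) {t : ℕ} {v : ℤ} (ht : |v| < B - t) :
    altL B t < v ↔ Even t := by
  rw [abs_lt] at ht
  rcases Nat.even_or_odd t with h | h
  · rw [altL_even B h]; simp [h]; omega
  · rw [altL_odd B h]; simp [Nat.not_even_iff_odd.mpr h]; omega

namespace Cyc
variable {n : ℕ} {g : Perm (Fin n)} {c : ℕ → Fin n} {p : ℕ}

lemma le_n (h : Cyc g c p) : p ≤ n := by
  have : Function.Injective (fun i : Fin p => c i) := fun i j hij => Fin.ext (h.inj i j i.2 j.2 hij)
  simpa using Fintype.card_le_of_injective _ this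

lemma self_upper (h : Cyc g c p) (hp2 : 2 ≤ p) (f : Fin n → ℤ) (hf : Function.Injective f) (B : ℤ)
    (hB : (p : ℤ) < B) (hfc : ∀ t < p, f (c t) = altL B t) :
    ∑ s ∈ Finset.range p, ∑ t ∈ Finset.range p, nc g f (c s) (c t) ≤ p + 2 * ((p - 1) / 2) := by
  obtain ⟨q, rfl⟩ : ∃ q, p = q + 1 := ⟨p - 1, by omega⟩
  have hc0 : c (q + 1) = c 0 := by simpa using h.per 0
  have main : ∀ s t, s < t → t < q + 1 → nc g f (c s) (c t) ≤ if t = q ∧ Odd s then 1 else 0 := by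
    intro s t hst ht
    unfold nc
    rw [← h.succ, ← h.succ, hfc s (by omega), hfc t ht, hfc (s + 1) (by omega)]
    simp only [altL_lt B hst (by omega)]
    by_cases htq : t = q
    · subst htq
      rw [hc0, hfc 0 (by omega)]
      have : ¬ (altL B (s + 1) < altL B 0) := by
        have := (altL_lt B (s := 0) (t := s + 1) (by omega) (by omega)).mpr (by simp)
        omega
      simp only [this]
      by_cases hs : Even s <;> simp [hs, Nat.not_even_iff_odd.mp]
    · rw [hfc (t + 1) (by omega)]
      simp only [altL_lt B (show s + 1 < t + 1 by omega) (by push_cast at *; omega)]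
      have : ¬ (Even s ↔ Even (s + 1)) := by rw [Nat.even_add_one]; tauto
      rw [if_neg this]; exact Nat.zero_le _
  have bound : ∀ s ∈ Finset.range (q + 1), ∀ t ∈ Finset.range (q + 1), nc g f (c s) (c t) ≤
      (if s = t then 1 else 0) + (if t = q then (if s < q ∧ Odd s then 1 else 0) else 0) +
      (if s = q then (if t < q ∧ Odd t then 1 else 0) else 0) := by
    intro s hs t ht
    simp only [Finset.mem_range] at hs ht
    rcases lt_trichotomy s t with h1 | h1 | h1
    · refine (main s t h1 ht).trans ?_
      by_cases h2 : t = q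
      · have : s < q := by omega
        simp [h2, this]
      · simp [h2]
    · simp only [h1, if_true]
      unfold nc
      split_ifs <;> omega
    · rw [nc_symm g f hf]
      refine (main t s h1 hs).trans ?_
      by_cases h2 : s = q
      · have : t < q := by omega
        simp [h2, this]
      · simp [h2]
  refine (Finset.sum_le_sum fun s hs => Finset.sum_le_sum fun t ht => bound s hs t ht).trans ?_
  simp only [Finset.sum_add_distrib]
  have e1 : ∑ s ∈ Finset.range (q + 1), ∑ t ∈ Finset.range (q + 1), (if s = t then 1 else 0) = q + 1 := by
    rw [Finset.sum_congr rfl (fun s hs => by rw [Finset.sum_ite_eq, if_pos hs])]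
    simp
  have e2 : ∑ t ∈ Finset.range (q + 1), (if t < q ∧ Odd t then 1 else 0) = q / 2 := by
    rw [Finset.sum_range_succ, ← count_odd_range]
    simp only [lt_irrefl, false_and, if_false, add_zero]
    refine Finset.sum_congr rfl fun t ht => ?_
    simp [Finset.mem_range.mp ht]
  have e3 : ∑ s ∈ Finset.range (q + 1), ∑ t ∈ Finset.range (q + 1),
      (if t = q then (if s < q ∧ Odd s then 1 else 0) else 0) = q / 2 := by
    rw [← e2]
    refine Finset.sum_congr rfl fun s _ => ?_
    rw [Finset.sum_ite_eq', if_pos (by simp)]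
  have e4 : ∑ s ∈ Finset.range (q + 1), ∑ t ∈ Finset.range (q + 1),
      (if s = q then (if t < q ∧ Odd t then 1 else 0) else 0) = q / 2 := by
    rw [Finset.sum_comm, ← e2]
    refine Finset.sum_congr rfl fun s _ => ?_
    rw [Finset.sum_ite_eq', if_pos (by simp)]
  rw [e1, e3, e4]
  simp; omega

lemma cross_upper (h : Cyc g c p) (f : Fin n → ℤ) (B : ℤ)
    (hfc : ∀ t < p, f (c t) = altL B t) (b : Fin n) (hb : |f b| < B - p) (hgb : |f (g b)| < B - p) :
    ∑ s ∈ Finset.range p, nc g f (c s) b ≤ if Odd p then 1 else 0 := by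
  have hp0 := h.pos
  obtain ⟨q, rfl⟩ : ∃ q, p = q + 1 := ⟨p - 1, by omega⟩
  have hc0 : c (q + 1) = c 0 := by simpa using h.per 0
  push_cast at hb hgb
  rw [Finset.sum_range_succ]
  have e1 : ∑ s ∈ Finset.range q, nc g f (c s) b = 0 := by
    apply Finset.sum_eq_zero
    intro s hs
    have hs := Finset.mem_range.mp hs
    unfold nc
    rw [← h.succ, hfc s (by omega), hfc (s + 1) (by omega)]
    simp only [altL_lt_of_abs B (t := s) (v := f b) (by omega),
      altL_lt_of_abs B (t := s + 1) (v := f (g b)) (by push_cast; omega)]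
    have : ¬ (Even s ↔ Even (s + 1)) := by rw [Nat.even_add_one]; tauto
    rw [if_neg this]
  rw [e1, zero_add]
  unfold nc
  rw [← h.succ, hc0, hfc q (by omega), hfc 0 (by omega)]
  simp only [altL_lt_of_abs B (t := q) (v := f b) (by omega),
      altL_lt_of_abs B (t := 0) (v := f (g b)) (by push_cast; omega)]
  by_cases hq : Even q
  · simp [hq, hq.add_one]
  · have : ¬ Odd (q + 1) := by
      rw [Nat.not_odd_iff_even, Nat.even_add_one]; exact hq
    simp [hq]

lemma cross_lower (h : Cyc g c p) (hp : Odd p) (f : Fin n → ℤ) (hf : Function.Injective f)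
    (D : Finset (Fin n)) (hD : ∀ y, g y ∈ D ↔ y ∈ D) (hDc : ∀ t, c t ∉ D)
    (hper : ∀ y ∈ D, Odd (Function.minimalPeriod g y) ∧ Function.minimalPeriod g y ≤ p) :
    D.card ≤ ∑ b ∈ D, ∑ s ∈ Finset.range p, nc g f (c s) b := by
  set φ : Fin n → ℕ := fun b => ∑ s ∈ Finset.range p, nc g f (c s) b with hφ
  set Q := p * ∏ b ∈ D, Function.minimalPeriod g b with hQ
  have hQo : Odd Q := by
    rw [hQ]
    apply hp.mul
    exact Finset.prod_induction _ Odd (fun a b ha hb => ha.mul hb) (by simp) (fun y hy => (hper y hy).1)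
  have hDpow : ∀ (t : ℕ) (y : Fin n), (g ^ t) y ∈ D ↔ y ∈ D := by
    intro t
    induction t with
    | zero => simp
    | succ t ih => intro y; rw [pow_succ', Perm.mul_apply, hD, ih]
  have key : ∀ b ∈ D, Q ≤ ∑ t ∈ Finset.range Q, φ ((g ^ t) b) := by
    intro b hb
    have cb := cyc_of g b
    have h1 : ∀ c0 ∈ Finset.range p, Q ≤ p * ∑ t ∈ Finset.range Q, nc g f (c (t + c0)) ((g ^ t) b) := by
      intro c0 _
      have := sturmST p (Function.minimalPeriod g b) Q hp (hper b hb).1 hQo (Dvd.intro _ rfl)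
        (Dvd.dvd.mul_left (Finset.dvd_prod_of_mem _ hb) _) (hper b hb).2
        (fun t => f (c (t + c0))) (fun t => f ((g ^ t) b))
        (fun t => by rw [show t + p + c0 = t + c0 + p by ring, h.per])
        (fun t => by rw [cb.per]) (fun t he => hDc (t + c0) (by
          rw [hf he]; exact (hDpow t b).mpr hb))
      rw [Finset.card_filter] at this
      refine this.trans (le_of_eq ?_)
      congr 1
      refine Finset.sum_congr rfl fun t _ => ?_
      unfold nc
      rw [← h.succ, show t + 1 + c0 = t + c0 + 1 by ring, pow_succ', Perm.mul_apply]
    have h2 := Finset.sum_le_sum h1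
    rw [Finset.sum_const, Finset.card_range, smul_eq_mul, ← Finset.mul_sum, Finset.sum_comm] at h2
    have h3 := Nat.le_of_mul_le_mul_left h2 h.pos
    refine h3.trans (le_of_eq ?_)
    refine Finset.sum_congr rfl fun t _ => ?_
    rw [hφ]
    simp only
    rw [← h.shift (fun y => nc g f y ((g ^ t) b)) t]
    refine Finset.sum_congr rfl fun s _ => ?_
    rw [add_comm]
  have h4 := Finset.sum_le_sum key
  rw [Finset.sum_const, smul_eq_mul, Finset.sum_comm] at h4
  have h5 : ∀ t ∈ Finset.range Q, ∑ b ∈ D, φ ((g ^ t) b) = ∑ b ∈ D, φ b := by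
    intro t _
    exact Finset.sum_equiv (g ^ t) (fun y => (hDpow t y).symm) (fun y _ => rfl)
  rw [Finset.sum_congr rfl h5, Finset.sum_const, Finset.card_range, smul_eq_mul, mul_comm] at h4
  exact Nat.le_of_mul_le_mul_left h4 hQo.pos

end Cyc

lemma KK_split {n : ℕ} (g : Perm (Fin n)) (f : Fin n → ℤ) (hf : Function.Injective f)
    (S D : Finset (Fin n)) (hSD : Disjoint S D) :
    KK g f = ∑ a ∈ S, ∑ b ∈ S, nc g f a b + 2 * (∑ b ∈ D, ∑ a ∈ S, nc g f a b)
      + 2 * (∑ a ∈ S, ∑ b ∈ (S ∪ D)ᶜ, nc g f a b) + ∑ a ∈ Sᶜ, ∑ b ∈ Sᶜ, nc g f a b := by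
  have e : ∀ u : Fin n → ℕ, ∑ b, u b = ∑ b ∈ S, u b + ∑ b ∈ Sᶜ, u b :=
    fun u => (Finset.sum_add_sum_compl S u).symm
  have e' : ∀ u : Fin n → ℕ, ∑ b ∈ Sᶜ, u b = ∑ b ∈ D, u b + ∑ b ∈ (S ∪ D)ᶜ, u b := by
    intro u
    have h1 := Finset.sum_add_sum_compl (S ∪ D) u
    rw [Finset.sum_union hSD] at h1
    have h2 := Finset.sum_add_sum_compl S u
    omega
  rw [KK_nc, e]
  simp only [e (fun b => nc g f _ b), Finset.sum_add_distrib]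
  have e3 : ∑ a ∈ Sᶜ, ∑ b ∈ S, nc g f a b = ∑ a ∈ S, ∑ b ∈ Sᶜ, nc g f a b := by
    rw [Finset.sum_comm]
    exact Finset.sum_congr rfl fun a _ => Finset.sum_congr rfl fun b _ => nc_symm g f hf _ _
  rw [e3]
  simp only [e' (fun b => nc g f _ b), Finset.sum_add_distrib]
  rw [Finset.sum_comm (s := D) (t := S)]
  ring

lemma relabel_KK {n : ℕ} {g : Perm (Fin n)} {c : ℕ → Fin n} {p : ℕ} (h : Cyc g c p) (hp2 : 2 ≤ p)
    (f f' : Fin n → ℤ) (hf : Function.Injective f) (hf' : Function.Injective f')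
    (T : Finset (Fin n)) (hT : ∀ y, g y ∈ T ↔ y ∈ T) (hcT : ∀ t, c t ∈ T) (B : ℤ)
    (hB : (n : ℤ) < B)
    (hB1 : ∀ y ∈ T, |f y| < B - n) (hB2 : ∀ y ∉ T, B < |f y|)
    (hpar : Even p ∨ (Odd p ∧ ∀ y ∈ T, Odd (Function.minimalPeriod g y) ∧
      Function.minimalPeriod g y ≤ p))
    (h1 : ∀ t < p, f' (c t) = altL B t)
    (h2 : ∀ y ∉ (Finset.range p).image c, f' y = f y) : KK g f' ≤ KK g f := by
  classical
  have hpn := h.le_n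
  set S := (Finset.range p).image c with hS
  set D := T \ S with hDdef
  have hSD : Disjoint S D := Finset.disjoint_sdiff
  have hST : S ⊆ T := by
    intro y hy
    obtain ⟨t, _, rfl⟩ := Finset.mem_image.mp hy
    exact hcT t
  have hU : S ∪ D = T := Finset.union_sdiff_of_subset hST
  rw [KK_split g f hf S D hSD, KK_split g f' hf' S D hSD, hU]
  have a1 : ∑ a ∈ S, ∑ b ∈ S, nc g f' a b ≤ ∑ a ∈ S, ∑ b ∈ S, nc g f a b := by
    rw [hS, h.sum_image, h.sum_image]
    simp only [h.sum_image]
    exact (h.self_upper hp2 f' hf' B (by omega) h1).trans (h.self_lower f hf)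
  have hDg : ∀ y, g y ∈ D ↔ y ∈ D := by
    intro y
    rw [hDdef, Finset.mem_sdiff, Finset.mem_sdiff, hT, hS, h.mem_iff]
  have hDS : ∀ y ∈ D, f' y = f y := fun y hy => h2 y (Finset.mem_sdiff.mp hy).2
  have a2 : ∑ b ∈ D, ∑ a ∈ S, nc g f' a b ≤ ∑ b ∈ D, ∑ a ∈ S, nc g f a b := by
    have u : ∀ b ∈ D, ∑ a ∈ S, nc g f' a b ≤ if Odd p then 1 else 0 := by
      intro b hb
      rw [hS, h.sum_image]
      have hgb := (hDg b).mpr hb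
      apply h.cross_upper f' B h1
      · rw [hDS b hb]; have := hB1 b (Finset.mem_sdiff.mp hb).1; omega
      · rw [hDS _ hgb]; have := hB1 _ (Finset.mem_sdiff.mp hgb).1; omega
    refine (Finset.sum_le_sum u).trans ?_
    rw [Finset.sum_const, smul_eq_mul]
    rcases hpar with hp | ⟨hp, hq⟩
    · rw [if_neg (Nat.not_odd_iff_even.mpr hp)]; simp
    · rw [if_pos hp, mul_one]
      have := h.cross_lower hp f hf D hDg
        (fun t ht => (Finset.mem_sdiff.mp ht).2 (h.mem t))
        (fun y hy => hq y (Finset.mem_sdiff.mp hy).1)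
      refine this.trans (le_of_eq ?_)
      refine Finset.sum_congr rfl fun b _ => ?_
      rw [hS, h.sum_image]
  have habs : ∀ s ∈ S, ∀ y ∉ T, (f' s < f' y ↔ f s < f y) := by
    intro s hs y hy
    obtain ⟨t, ht, rfl⟩ := Finset.mem_image.mp hs
    have ht := Finset.mem_range.mp ht
    rw [h1 t ht, h2 y (fun hy' => hy (hST hy'))]
    have b1 := hB1 _ (hcT t)
    have b2 := hB2 y hy
    have b3 : |altL B t| ≤ B := by
      unfold altL
      rw [abs_mul, abs_pow]
      simp only [abs_neg, abs_one, one_pow, one_mul]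
      rw [abs_le]; omega
    rw [abs_lt] at b1
    rw [abs_le] at b3
    rw [lt_abs] at b2
    omega
  have a3 : ∑ a ∈ S, ∑ b ∈ Tᶜ, nc g f' a b = ∑ a ∈ S, ∑ b ∈ Tᶜ, nc g f a b := by
    refine Finset.sum_congr rfl fun a ha => Finset.sum_congr rfl fun b hb => ?_
    have hb := Finset.mem_compl.mp hb
    unfold nc
    simp only [habs a ha b hb, habs (g a) ((h.mem_iff a).mpr ha) (g b) (fun h' => hb ((hT b).mp h'))]
  have a4 : ∑ a ∈ Sᶜ, ∑ b ∈ Sᶜ, nc g f' a b = ∑ a ∈ Sᶜ, ∑ b ∈ Sᶜ, nc g f a b := by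
    refine Finset.sum_congr rfl fun a ha => Finset.sum_congr rfl fun b hb => ?_
    have ha := Finset.mem_compl.mp ha
    have hb := Finset.mem_compl.mp hb
    unfold nc
    rw [h2 a ha, h2 b hb, h2 (g a) (fun h' => ha ((h.mem_iff a).mp h')),
      h2 (g b) (fun h' => hb ((h.mem_iff b).mp h'))]
  omega

lemma relabel {n : ℕ} {g : Perm (Fin n)} {c : ℕ → Fin n} {p : ℕ} (h : Cyc g c p) (hp2 : 2 ≤ p)
    (f : Fin n → ℤ) (hf : Function.Injective f)
    (T : Finset (Fin n)) (hT : ∀ y, g y ∈ T ↔ y ∈ T) (hcT : ∀ t, c t ∈ T) (B : ℤ)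
    (hB : (n : ℤ) < B)
    (hB1 : ∀ y ∈ T, |f y| < B - n) (hB2 : ∀ y ∉ T, B < |f y|)
    (hpar : Even p ∨ (Odd p ∧ ∀ y ∈ T, Odd (Function.minimalPeriod g y) ∧
      Function.minimalPeriod g y ≤ p)) :
    ∃ f' : Fin n → ℤ, Function.Injective f' ∧ KK g f' ≤ KK g f ∧
      (∀ t < p, f' (c t) = altL B t) ∧ (∀ y ∉ (Finset.range p).image c, f' y = f y) := by
  classical
  have hpn := h.le_n
  have hex : ∀ y ∈ (Finset.range p).image c, ∃ t, t < p ∧ c t = y := by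
    intro y hy; simpa using hy
  let f' : Fin n → ℤ := fun y => if hy : y ∈ (Finset.range p).image c then
    altL B (hex y hy).choose else f y
  have h1 : ∀ t < p, f' (c t) = altL B t := by
    intro t ht
    have hm := h.mem t
    have hs := (hex _ hm).choose_spec
    have : (hex _ hm).choose = t := h.inj _ _ hs.1 ht hs.2
    simp only [f', dif_pos hm, this]
  have h2 : ∀ y ∉ (Finset.range p).image c, f' y = f y := by
    intro y hy; simp only [f', dif_neg hy]
  have b3 : ∀ t < p, B - n < |altL B t| ∧ |altL B t| ≤ B := by
    intro t ht
    unfold altL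
    rw [abs_mul, abs_pow]
    simp only [abs_neg, abs_one, one_pow, one_mul]
    rw [abs_of_nonneg (by omega)]; omega
  have hmix : ∀ t < p, ∀ y ∉ (Finset.range p).image c, f' (c t) ≠ f' y := by
    intro t ht y hy he
    rw [h1 t ht, h2 y hy] at he
    have b := b3 t ht
    rw [he] at b
    by_cases hyT : y ∈ T
    · have := hB1 y hyT; omega
    · have := hB2 y hyT; omega
  have hinj : Function.Injective f' := by
    intro a b hab
    by_cases ha : a ∈ (Finset.range p).image c
    · obtain ⟨s, hs, rfl⟩ := hex a ha
      by_cases hb : b ∈ (Finset.range p).image c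
      · obtain ⟨t, ht, rfl⟩ := hex b hb
        rw [h1 s hs, h1 t ht] at hab
        by_contra hne
        have hst : s ≠ t := fun h => hne (by rw [h])
        rcases lt_or_gt_of_ne hst with h' | h'
        · have e1 := b3 s hs
          have : |altL B s| = |altL B t| := by rw [hab]
          unfold altL at this
          rw [abs_mul, abs_pow, abs_mul, abs_pow] at this
          simp only [abs_neg, abs_one, one_pow, one_mul] at this
          rw [abs_of_nonneg (by omega), abs_of_nonneg (by omega)] at this
          omega
        · have e1 := b3 s hs
          have : |altL B s| = |altL B t| := by rw [hab]
          unfold altL at this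
          rw [abs_mul, abs_pow, abs_mul, abs_pow] at this
          simp only [abs_neg, abs_one, one_pow, one_mul] at this
          rw [abs_of_nonneg (by omega), abs_of_nonneg (by omega)] at this
          omega
      · exact absurd hab (hmix s hs b hb)
    · by_cases hb : b ∈ (Finset.range p).image c
      · obtain ⟨t, ht, rfl⟩ := hex b hb
        exact absurd hab.symm (hmix t ht a ha)
      · rw [h2 a ha, h2 b hb] at hab
        exact hf hab
  exact ⟨f', hinj, relabel_KK h hp2 f f' hf hinj T hT hcT B hB hB1 hB2 hpar h1 h2, h1, h2⟩

/-- period of a point -/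
noncomputable abbrev mper {n : ℕ} (g : Perm (Fin n)) (x : Fin n) : ℕ := Function.minimalPeriod g x

/-- the orbit of a point -/
noncomputable def orb {n : ℕ} (g : Perm (Fin n)) (x : Fin n) : Finset (Fin n) :=
  (Finset.range (mper g x)).image (fun t => (g ^ t) x)

lemma mem_orb {n : ℕ} (g : Perm (Fin n)) (x y : Fin n) : y ∈ orb g x ↔ g.SameCycle x y := by
  constructor
  · intro h
    obtain ⟨t, _, rfl⟩ := Finset.mem_image.mp h
    exact ⟨t, by simp⟩
  · intro h
    obtain ⟨i, _, _, rfl⟩ := h.exists_pow_eq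
    exact (cyc_of g x).mem i

lemma card_orb {n : ℕ} (g : Perm (Fin n)) (x : Fin n) : (orb g x).card = mper g x := by
  unfold orb
  rw [Finset.card_image_of_injOn, Finset.card_range]
  intro s hs t ht h
  exact (cyc_of g x).inj s t (by simpa using hs) (by simpa using ht) h

lemma mper_pos {n : ℕ} (g : Perm (Fin n)) (x : Fin n) : 0 < mper g x := (cyc_of g x).pos

lemma mper_eq_card {n : ℕ} (g : Perm (Fin n)) (x : Fin n) (hx : x ∈ g.support) :
    mper g x = (g.cycleOf x).support.card := by
  rw [← card_orb]
  congr 1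
  ext y
  rw [mem_orb, Perm.mem_support_cycleOf_iff]
  simp [hx]

lemma mper_one_iff {n : ℕ} (g : Perm (Fin n)) (x : Fin n) : mper g x = 1 ↔ g x = x :=
  Function.minimalPeriod_eq_one_iff_isFixedPt

/-- The key description of the cycle type. -/
lemma count_fct {n : ℕ} (g : Perm (Fin n)) (p : ℕ) :
    p * (fullCycleType n g).count p = (Finset.univ.filter (fun y => mper g y = p)).card := by
  classical
  rcases Nat.lt_or_ge p 2 with hp | hp
  · interval_cases p
    · rw [zero_mul, eq_comm, Finset.card_eq_zero, Finset.filter_eq_empty_iff]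
      intro y _ h
      exact (mper_pos g y).ne' h
    · rw [one_mul, fullCycleType, Multiset.count_add, Multiset.count_replicate_self,
        Multiset.count_eq_zero_of_notMem (fun h => absurd (Perm.two_le_of_mem_cycleType h) (by omega)),
        zero_add, Perm.sum_cycleType]
      have : Finset.univ.filter (fun y => mper g y = 1) = g.supportᶜ := by
        ext y; simp [Perm.mem_support, Function.IsFixedPt]
      rw [this, Finset.card_compl, Fintype.card_fin]
  · rw [fullCycleType, Multiset.count_add, Multiset.count_replicate, if_neg (by omega), add_zero,
      Perm.cycleType_def, Multiset.count_map]
    have e : Finset.univ.filter (fun y => mper g y = p) =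
        (g.cycleFactorsFinset.filter (fun c => p = c.support.card)).biUnion (fun c => c.support) := by
      ext y
      simp only [Finset.mem_filter, Finset.mem_univ, true_and, Finset.mem_biUnion]
      constructor
      · intro h
        have hy : y ∈ g.support := by
          rw [Perm.mem_support]; intro h'; rw [(mper_one_iff g y).mpr h'] at h; omega
        refine ⟨g.cycleOf y, ⟨Perm.cycleOf_mem_cycleFactorsFinset_iff.mpr hy, ?_⟩, ?_⟩
        · rw [← h, mper_eq_card g y hy]
        · rw [Perm.mem_support_cycleOf_iff]; exact ⟨Perm.SameCycle.refl _ _, hy⟩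
      · rintro ⟨c, ⟨hc, hcp⟩, hy⟩
        have := Perm.cycle_is_cycleOf hy hc
        rw [mper_eq_card g y (Perm.mem_cycleFactorsFinset_support_le hc hy), ← this, hcp]
    rw [e, Finset.card_biUnion]
    · rw [Finset.sum_congr rfl (g := fun _ => p) (fun c hc => (Finset.mem_filter.mp hc).2.symm)]
      rw [Finset.sum_const, smul_eq_mul, mul_comm]
      rfl
    · intro c hc d hd hcd
      have := Perm.cycleFactorsFinset_pairwise_disjoint g (Finset.mem_filter.mp hc).1
        (Finset.mem_filter.mp hd).1 hcd
      exact this.disjoint_support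

lemma fct_pos {n : ℕ} (g : Perm (Fin n)) : (fullCycleType n g).count 0 = 0 := by
  rw [Multiset.count_eq_zero, fullCycleType, Multiset.mem_add]
  rintro (h | h)
  · exact absurd (Perm.two_le_of_mem_cycleType h) (by omega)
  · have := Multiset.eq_of_mem_replicate h; omega

lemma fct_sum {n : ℕ} (g : Perm (Fin n)) : (fullCycleType n g).sum = n := by
  rw [fullCycleType, Multiset.sum_add, Multiset.sum_replicate, smul_eq_mul, mul_one]
  have : g.cycleType.sum ≤ n := by
    rw [Perm.sum_cycleType]; simpa using Finset.card_le_univ g.support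
  omega

lemma fct_eq_iff {n : ℕ} (g : Perm (Fin n)) (mu : Multiset ℕ) (h0 : mu.count 0 = 0) :
    fullCycleType n g = mu ↔
      ∀ p, (Finset.univ.filter (fun y => mper g y = p)).card = p * mu.count p := by
  constructor
  · rintro rfl p; exact (count_fct g p).symm
  · intro h
    ext p
    rcases Nat.eq_zero_or_pos p with rfl | hp
    · rw [h0, fct_pos]
    · have := count_fct g p
      rw [h] at this
      exact Nat.eq_of_mul_eq_mul_left hp this

lemma fct_mem {n : ℕ} (g : Perm (Fin n)) (x : Fin n) : mper g x ∈ fullCycleType n g := by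
  have := count_fct g (mper g x)
  have h2 : 0 < (Finset.univ.filter (fun y => mper g y = mper g x)).card :=
    Finset.card_pos.mpr ⟨x, by simp⟩
  rw [← this] at h2
  exact Multiset.count_pos.mp (Nat.pos_of_mul_pos_left h2)

lemma fct_exists {n : ℕ} (g : Perm (Fin n)) (p : ℕ) (hp : p ∈ fullCycleType n g) :
    ∃ x, mper g x = p := by
  have := count_fct g p
  have hp0 : 0 < p := by
    rcases Nat.eq_zero_or_pos p with rfl | h
    · exact absurd (fct_pos g) (Multiset.count_ne_zero.mpr hp)
    · exact h
  have h2 : 0 < p * (fullCycleType n g).count p := Nat.mul_pos hp0 (Multiset.count_pos.mpr hp)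
  rw [this, Finset.card_pos] at h2
  obtain ⟨x, hx⟩ := h2
  exact ⟨x, by simpa using hx⟩

lemma mper_of_sameCycle {n : ℕ} {g : Perm (Fin n)} {x y : Fin n} (h : g.SameCycle x y) :
    mper g x = mper g y := by
  rw [← card_orb, ← card_orb]
  congr 1
  ext z
  rw [mem_orb, mem_orb]
  exact ⟨fun h' => h.symm.trans h', fun h' => h.trans h'⟩

/-- if `p` occurs at least twice, we find a second orbit -/
lemma fct_exists_two {n : ℕ} (g : Perm (Fin n)) (p : ℕ) (hp : 2 ≤ (fullCycleType n g).count p)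
    (x : Fin n) (hx : mper g x = p) : ∃ y, mper g y = p ∧ y ∉ orb g x := by
  have := count_fct g p
  have hp0 : 0 < p := hx ▸ mper_pos g x
  have h1 : (orb g x).card < (Finset.univ.filter (fun y => mper g y = p)).card := by
    rw [card_orb, hx, ← this]; nlinarith
  obtain ⟨y, hy, hy'⟩ := Finset.exists_mem_notMem_of_card_lt_card h1
  exact ⟨y, by simpa using hy, hy'⟩

lemma exists_fct {n : ℕ} (mu : Multiset ℕ) (hs : mu.sum = n) (hpos : ∀ p ∈ mu, 0 < p) :
    ∃ g : Perm (Fin n), fullCycleType n g = mu := by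
  classical
  have hsplit := Multiset.filter_add_not (fun p => 2 ≤ p) mu
  have hrep : mu.filter (fun p => ¬ 2 ≤ p) =
      Multiset.replicate (Multiset.card (mu.filter (fun p => ¬ 2 ≤ p))) 1 := by
    rw [Multiset.eq_replicate]
    refine ⟨rfl, fun b hb => ?_⟩
    have h1 := Multiset.of_mem_filter hb
    have h2 := hpos b (Multiset.mem_of_mem_filter hb)
    omega
  set r := Multiset.card (mu.filter (fun p => ¬ 2 ≤ p)) with hr
  have hsum : (mu.filter (fun p => 2 ≤ p)).sum + r = n := by
    rw [← hs]
    conv_rhs => rw [← hsplit, hrep]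
    simp
  have : ∃ g : Perm (Fin n), g.cycleType = mu.filter (fun p => 2 ≤ p) := by
    rw [Perm.exists_with_cycleType_iff]
    refine ⟨by rw [Fintype.card_fin]; omega, fun a ha => Multiset.of_mem_filter ha⟩
  obtain ⟨g, hg⟩ := this
  refine ⟨g, ?_⟩
  rw [fullCycleType, hg]
  conv_rhs => rw [← hsplit, hrep]
  congr 2
  omega

lemma fct_conj {n : ℕ} (g σ : Perm (Fin n)) : fullCycleType n (σ * g * σ⁻¹) = fullCycleType n g := by
  rw [fullCycleType, fullCycleType, Perm.cycleType_conj]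

/-- minimal elements in terms of `g = w w₀` -/
def Gmin (n : ℕ) (mu : Multiset ℕ) (g : Perm (Fin n)) : Prop :=
  fullCycleType n g = mu ∧ ∀ g' : Perm (Fin n), fullCycleType n g' = mu → K0 g ≤ K0 g'

lemma rev_rev_mul {n : ℕ} (g : Perm (Fin n)) : g * Fin.revPerm * Fin.revPerm = g := by
  ext; simp

lemma min_iff {n : ℕ} (mu : Multiset ℕ) (w : Perm (Fin n)) :
    isMinimalIn n mu w ↔ Gmin n mu (w * Fin.revPerm) := by
  unfold isMinimalIn Gmin inClass
  refine and_congr_right fun _ => ⟨fun h g' hg' => ?_, fun h z hz => ?_⟩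
  · have := h (g' * Fin.revPerm) (by rw [rev_rev_mul]; exact hg')
    have a1 := permLength_K0 w
    have a2 := permLength_K0 (g' * Fin.revPerm)
    rw [rev_rev_mul] at a2
    omega
  · have := h _ hz
    have a1 := permLength_K0 w
    have a2 := permLength_K0 z
    omega

lemma exists_Gmin {n : ℕ} (mu : Multiset ℕ) (h : ∃ g : Perm (Fin n), fullCycleType n g = mu) :
    ∃ g : Perm (Fin n), Gmin n mu g := by
  classical
  obtain ⟨g, hg⟩ := h
  obtain ⟨g', h1, h2⟩ := Finset.exists_min_image
    (Finset.univ.filter (fun g : Perm (Fin n) => fullCycleType n g = mu)) K0 ⟨g, by simpa using hg⟩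
  exact ⟨g', by simpa using h1, fun g'' h'' => h2 g'' (by simpa using h'')⟩

lemma standardize {n : ℕ} (g : Perm (Fin n)) (f : Fin n → ℤ) (hf : Function.Injective f) :
    ∃ σ : Perm (Fin n), (∀ a b, σ a < σ b ↔ f a < f b) ∧ K0 (σ * g * σ⁻¹) = KK g f := by
  have hmono := Tuple.monotone_sort f
  set τ := Tuple.sort f with hτ
  have hstrict : StrictMono (f ∘ τ) := hmono.strictMono_of_injective (hf.comp τ.injective)
  have hσ : ∀ a b, τ⁻¹ a < τ⁻¹ b ↔ f a < f b := by
    intro a b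
    have := hstrict.lt_iff_lt (a := τ⁻¹ a) (b := τ⁻¹ b)
    simpa using this.symm
  refine ⟨τ⁻¹, hσ, ?_⟩
  unfold K0 KK
  rw [← Equiv.sum_comp τ⁻¹]
  refine Finset.sum_congr rfl fun a _ => ?_
  rw [← Equiv.sum_comp τ⁻¹]
  refine Finset.sum_congr rfl fun b _ => ?_
  simp only [id, Perm.mul_apply, inv_inv]
  have e : ∀ c, τ (τ⁻¹ c) = c := fun c => by simp
  simp only [e, hσ]

lemma K0_eq_KK {n : ℕ} (g : Perm (Fin n)) : K0 g = KK g (fun a => (a.val : ℤ)) := by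
  unfold K0 KK
  simp

/-- the partition `(3^k, 2, 1^{n-2-3k})` -/
abbrev lam (n k : ℕ) : Multiset ℕ :=
  Multiset.replicate k 3 + (2 ::ₘ Multiset.replicate (n - 2 - 3 * k) 1)

lemma lam_count (n k p : ℕ) : (lam n k).count p =
    (if p = 3 then k else 0) + (if p = 2 then 1 else 0) + (if p = 1 then n - 2 - 3 * k else 0) := by
  unfold lam
  rw [Multiset.count_add, Multiset.count_cons, Multiset.count_replicate, Multiset.count_replicate]
  split_ifs <;> omega

lemma mper_pow_three {n : ℕ} {g : Perm (Fin n)} {y : Fin n} (h : mper g y ∣ 3) : (g (g (g y))) = y := by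
  have := Function.isPeriodicPt_iff_minimalPeriod_dvd.mpr h
  exact this

lemma lam_struct {n k : ℕ} {g : Perm (Fin n)} (hg : fullCycleType n g = lam n k) :
    ∃ x, mper g x = 2 ∧ g x ≠ x ∧ g (g x) = x ∧ ∀ y, y ≠ x → y ≠ g x → g (g (g y)) = y := by
  classical
  obtain ⟨x, hx⟩ := fct_exists g 2 (by rw [hg]; simp [lam])
  have hxx : g (g x) = x := by
    have : Function.IsPeriodicPt g 2 x := Function.isPeriodicPt_iff_minimalPeriod_dvd.mpr (by
      have : Function.minimalPeriod g x = 2 := hx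
      rw [this])
    exact this
  have hne : g x ≠ x := fun h => by
    have := (mper_one_iff g x).mpr h
    omega
  have hgx : mper g (g x) = 2 := by
    rw [← hx]; symm; apply mper_of_sameCycle; exact ⟨1, by simp⟩
  refine ⟨x, hx, hne, hxx, fun y h1 h2 => ?_⟩
  apply mper_pow_three
  have hmem := fct_mem g y
  have hc := count_fct g 2
  rw [hg, lam_count] at hc
  norm_num at hc
  have hset : ({x, g x} : Finset (Fin n)) = Finset.univ.filter (fun y => mper g y = 2) := by
    apply Finset.eq_of_subset_of_card_le
    · intro z hz
      simp only [Finset.mem_insert, Finset.mem_singleton] at hz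
      rcases hz with rfl | rfl
      · simpa using hx
      · simpa using hgx
    · rw [Finset.card_pair hne.symm, ← hc]
  have h3 : mper g y ≠ 2 := by
    intro h
    have : y ∈ ({x, g x} : Finset (Fin n)) := by rw [hset]; simpa using h
    simp [h1, h2] at this
  rw [hg] at hmem
  simp only [lam, Multiset.mem_add, Multiset.mem_cons, Multiset.mem_replicate] at hmem
  rcases hmem with h | h | h
  · rw [h.2]
  · exact absurd h h3
  · rw [h.2]; norm_num

lemma uv_bound {n : ℕ} (g : Perm (Fin n)) (x : Fin n)
    (h3 : ∀ y, y ≠ x → y ≠ g x → g (g (g y)) = y) (U V : Finset (Fin n)) (hUV : Disjoint U V) :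
    3 * ((U.filter (fun a => g a ∈ V)).card + (V.filter (fun a => g a ∈ U)).card) ≤
      2 + 2 * (U.card + V.card) := by
  classical
  set bad := (U.filter (fun a => g a ∉ V)) ∪ (V.filter (fun a => g a ∉ U)) with hbad
  have c1 := Finset.card_filter_add_card_filter_not (s := U) (fun a => g a ∈ V)
  have c2 := Finset.card_filter_add_card_filter_not (s := V) (fun a => g a ∈ U)
  have cb : bad.card ≤ (U.filter (fun a => g a ∉ V)).card + (V.filter (fun a => g a ∉ U)).card :=
    Finset.card_union_le _ _
  have hsub : U ∪ V ⊆ {x, g x} ∪ (bad ∪ (bad.image (fun y => g⁻¹ y) ∪ bad.image (fun y => g⁻¹ (g⁻¹ y)))) := by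
    intro y hy
    by_contra hcon
    simp only [Finset.mem_union, Finset.mem_insert, Finset.mem_singleton, Finset.mem_image, not_or,
      not_exists, not_and] at hcon
    obtain ⟨⟨hy1, hy2⟩, hb0, hb1, hb2⟩ := hcon
    have hb1 : g y ∉ bad := fun h => hb1 _ h (by simp)
    have hb2 : g (g y) ∉ bad := fun h => hb2 _ h (by simp)
    have e := h3 y hy1 hy2
    have d := Finset.disjoint_left.mp hUV
    simp only [hbad, Finset.mem_union, Finset.mem_filter] at hb0 hb1 hb2 hy
    rw [e] at hb2
    have d0 := @d y
    tauto
  have k1 := Finset.card_le_card hsub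
  rw [Finset.card_union_of_disjoint hUV] at k1
  have k2 := Finset.card_union_le ({x, g x} : Finset (Fin n)) (bad ∪ (bad.image (fun y => g⁻¹ y) ∪ bad.image (fun y => g⁻¹ (g⁻¹ y))))
  have k3 := Finset.card_union_le bad (bad.image (fun y => g⁻¹ y) ∪ bad.image (fun y => g⁻¹ (g⁻¹ y)))
  have k4 := Finset.card_union_le (bad.image (fun y => g⁻¹ y)) (bad.image (fun y => g⁻¹ (g⁻¹ y)))
  have k5 := Finset.card_image_le (s := bad) (f := fun y => g⁻¹ y)
  have k6 := Finset.card_image_le (s := bad) (f := fun y => g⁻¹ (g⁻¹ y))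
  have k7 := Finset.card_le_two (a := x) (b := g x)
  omega

lemma card_val_lt {n i : ℕ} (hi : i ≤ n) : (Finset.univ.filter (fun a : Fin n => a.val < i)).card = i := by
  have := Fin.card_filter_val_lt (n := n) (m := i)
  simpa [hi] using this

lemma cross_UV {n : ℕ} (g : Perm (Fin n)) (u w : ℕ) (hu : u ≤ n) :
    ((Finset.univ.filter (fun a : Fin n => w ≤ a.val)).filter (fun a => g a ∈ Finset.univ.filter (fun a : Fin n => a.val < u))).card
    + (Finset.univ.filter (fun a : Fin n => (g a).val < u ∧ a.val < w)).card = u := by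
  have h1 : (Finset.univ.filter (fun a : Fin n => (g a).val < u)).card = u := by
    conv_rhs => rw [← card_val_lt hu]
    apply Finset.card_bij (fun a _ => g a)
    · intro a ha; simpa using ha
    · intro a _ b _ h; simpa using h
    · intro b hb; exact ⟨g⁻¹ b, by simpa using hb, by simp⟩
  have h2 := Finset.card_filter_add_card_filter_not
    (s := Finset.univ.filter (fun a : Fin n => (g a).val < u)) (fun a => w ≤ a.val)
  rw [h1, Finset.filter_filter, Finset.filter_filter] at h2
  rw [Finset.filter_filter]
  simp only [Finset.mem_filter, Finset.mem_univ, true_and]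
  refine Eq.trans ?_ h2
  congr 2
  · ext a; simp only [Finset.mem_filter, Finset.mem_univ, true_and]; omega
  · ext a; simp only [Finset.mem_filter, Finset.mem_univ, true_and]; omega

lemma cross_VU {n : ℕ} (g : Perm (Fin n)) (u w : ℕ) (hu : u ≤ n) :
    ((Finset.univ.filter (fun a : Fin n => a.val < u)).filter (fun a => g a ∈ Finset.univ.filter (fun a : Fin n => w ≤ a.val))).card
    + (Finset.univ.filter (fun a : Fin n => (g a).val < w ∧ a.val < u)).card = u := by
  have h1 := card_val_lt hu
  have h2 := Finset.card_filter_add_card_filter_not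
    (s := Finset.univ.filter (fun a : Fin n => a.val < u)) (fun a => w ≤ (g a).val)
  rw [h1, Finset.filter_filter, Finset.filter_filter] at h2
  rw [Finset.filter_filter]
  simp only [Finset.mem_filter, Finset.mem_univ, true_and]
  refine Eq.trans ?_ h2
  congr 2
  · ext a; simp only [Finset.mem_filter, Finset.mem_univ, true_and]; omega

/-- the main obstruction -/
lemma obstruct {n k : ℕ} {mu : Multiset ℕ} (hle : classLE n (lam n k) mu) (g : Perm (Fin n))
    (hg : Gmin n mu g) (f : Fin n → ℤ) (hf : Function.Injective f) (hK : KK g f ≤ K0 g)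
    (N : ℤ) (hN : 0 ≤ N) (A : Finset (Fin n))
    (hA : ∀ a ∈ A, (f a < -N ∧ N < f (g a)) ∨ (N < f a ∧ f (g a) < -N)) :
    3 * A.card ≤ 2 + 2 * (Finset.univ.filter (fun a => N < |f a|)).card := by
  classical
  obtain ⟨σ, hσ, hσK⟩ := standardize g f hf
  set x := σ * g * σ⁻¹ with hx
  have hxmin : Gmin n mu x := by
    refine ⟨by rw [hx, fct_conj, hg.1], fun g' hg' => ?_⟩
    rw [hσK]; exact hK.trans (hg.2 g' hg')
  obtain ⟨x', hx'min, hbr⟩ := hle (x * Fin.revPerm) ((min_iff _ _).mpr (by rw [rev_rev_mul]; exact hxmin))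
  rw [min_iff] at hx'min
  set g' := x' * Fin.revPerm with hg'
  have hrank := bruhat_rank' hbr
  rw [rev_rev_mul, ← hg'] at hrank
  obtain ⟨x0, _, _, _, h3⟩ := lam_struct hx'min.1
  set Uf := Finset.univ.filter (fun a => f a < -N) with hUf
  set Vf := Finset.univ.filter (fun a => N < f a) with hVf
  -- initial segments
  have seg : ∀ (P : Fin n → Prop) [DecidablePred P], (∀ a b, f a < f b → P b → P a) →
      ∀ a, P a ↔ (σ a).val < (Finset.univ.filter P).card := by
    intro P _ hP a
    have him : (Finset.univ.filter (fun b : Fin n => b.val < (σ a).val)).card = (σ a).val :=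
      card_val_lt (σ a).2.le
    constructor
    · intro ha
      rw [← him]
      have hcard : ((Finset.univ.filter P).image σ).card = (Finset.univ.filter P).card :=
        Finset.card_image_of_injective _ σ.injective
      rw [← hcard]
      apply Finset.card_lt_card
      rw [Finset.ssubset_iff_of_subset]
      · exact ⟨σ a, Finset.mem_image_of_mem _ (by simpa using ha), by simp⟩
      · intro b hb
        refine Finset.mem_image.mpr ⟨σ⁻¹ b, ?_, by simp⟩
        simp only [Finset.mem_filter, Finset.mem_univ, true_and] at hb ⊢
        apply hP _ _ ((hσ (σ⁻¹ b) a).mp (by simpa using hb)) ha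
    · intro ha
      by_contra hna
      have : (Finset.univ.filter P).card ≤ (σ a).val := by
        rw [← him, ← Finset.card_image_of_injective (Finset.univ.filter P) σ.injective]
        apply Finset.card_le_card
        intro b hb
        obtain ⟨y, hy, rfl⟩ := Finset.mem_image.mp hb
        simp only [Finset.mem_filter, Finset.mem_univ, true_and] at hy ⊢
        rw [← Fin.lt_def, hσ]
        by_contra hlt
        have hne : f y ≠ f a := fun h => hna (hf h ▸ hy)
        exact hna (hP a y (by omega) hy)
      omega
  set u := Uf.card with hu
  set w := (Finset.univ.filter (fun a => f a ≤ N)).card with hw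
  have sU : ∀ a, f a < -N ↔ (σ a).val < u := seg (fun a => f a < -N) (fun a b h1 h2 => by omega)
  have sW : ∀ a, f a ≤ N ↔ (σ a).val < w := seg (fun a => f a ≤ N) (fun a b h1 h2 => by omega)
  have hun : u ≤ n := by simpa using Finset.card_le_univ Uf
  set U := Finset.univ.filter (fun a : Fin n => a.val < u) with hU
  set V := Finset.univ.filter (fun a : Fin n => w ≤ a.val) with hV
  have hUc : U.card = u := card_val_lt hun
  have hVc : V.card = Vf.card := by
    rw [← Finset.card_image_of_injective Vf σ.injective]
    congr 1
    ext b
    simp only [hV, hVf, Finset.mem_image, Finset.mem_filter, Finset.mem_univ, true_and]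
    constructor
    · intro hb
      refine ⟨σ⁻¹ b, ?_, by simp⟩
      have := sW (σ⁻¹ b)
      have e : σ (σ⁻¹ b) = b := by simp
      rw [e] at this
      omega
    · rintro ⟨a, ha, rfl⟩
      have := sW a
      omega
  have huw : u ≤ w := by
    apply Finset.card_le_card
    intro a; simp [hUf]; omega
  have hUV : Disjoint U V := by
    rw [Finset.disjoint_left]
    intro a; simp [hU, hV]; omega
  have hb := uv_bound g' x0 h3 U V hUV
  have r1 := hrank u w
  have r2 := hrank w u
  have e1 := cross_UV g' u w hun
  have e2 := cross_UV x u w hun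
  have e3 := cross_VU g' u w hun
  have e4 := cross_VU x u w hun
  rw [← hU, ← hV] at e1 e2 e3 e4
  have hAcard : A.card ≤ (U.filter (fun a => x a ∈ V)).card + (V.filter (fun a => x a ∈ U)).card := by
    rw [← Finset.card_image_of_injective A σ.injective]
    refine le_trans (Finset.card_le_card ?_) (Finset.card_union_le _ _)
    intro b hb
    obtain ⟨a, ha, rfl⟩ := Finset.mem_image.mp hb
    have hxa : x (σ a) = σ (g a) := by simp [hx]
    simp only [Finset.mem_union, Finset.mem_filter, hxa, hU, hV, Finset.mem_univ, true_and]
    have s1 := sU a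
    have s2 := sW a
    have s3 := sU (g a)
    have s4 := sW (g a)
    rcases hA a ha with h | h <;> omega
  have hWc : (Finset.univ.filter (fun a => N < |f a|)).card = Uf.card + Vf.card := by
    rw [← Finset.card_union_of_disjoint]
    · congr 1
      ext a
      simp only [hUf, hVf, Finset.mem_filter, Finset.mem_univ, true_and, Finset.mem_union, lt_abs]
      omega
    · rw [Finset.disjoint_left]
      intro a; simp [hUf, hVf]; omega
  rw [hWc]
  omega

lemma altL_abs (B : ℤ) (t : ℕ) (h : (t : ℤ) ≤ B) : |altL B t| = B - t := by
  rcases Nat.even_or_odd t with ht | ht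
  · rw [altL_even _ ht, abs_neg, abs_of_nonneg (by omega)]
  · rw [altL_odd _ ht, abs_of_nonneg (by omega)]

lemma orb_mem_iff {n : ℕ} (g : Perm (Fin n)) (x y : Fin n) : g y ∈ orb g x ↔ y ∈ orb g x := by
  rw [mem_orb, mem_orb]; exact Equiv.Perm.sameCycle_apply_right

lemma mper_le_n {n : ℕ} (g : Perm (Fin n)) (x : Fin n) : mper g x ≤ n := (cyc_of g x).le_n

lemma cycA {n : ℕ} (g : Perm (Fin n)) (x : Fin n) (f : Fin n → ℤ) (B N : ℤ)
    (hf : ∀ t < mper g x, f ((g ^ t) x) = altL B t) (hN0 : 0 ≤ N) (hN : N ≤ B - n) (hp : 2 ≤ mper g x) :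
    ∃ A : Finset (Fin n), A ⊆ orb g x ∧ A.card = 2 * (mper g x / 2) ∧
      (∀ a ∈ A, (f a < -N ∧ N < f (g a)) ∨ (N < f a ∧ f (g a) < -N)) := by
  classical
  have hc := cyc_of g x
  have hpn := mper_le_n g x
  refine ⟨(Finset.range (2 * (mper g x / 2))).image (fun t => (g ^ t) x), ?_, ?_, ?_⟩
  · apply Finset.image_subset_image
    intro t; simp only [Finset.mem_range]; omega
  · rw [Finset.card_image_of_injOn, Finset.card_range]
    intro s hs t ht h
    simp only [Finset.coe_range, Set.mem_Iio] at hs ht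
    exact hc.inj s t (show s < mper g x by omega) (show t < mper g x by omega) h
  · intro a ha
    obtain ⟨t, ht, rfl⟩ := Finset.mem_image.mp ha
    simp only [Finset.mem_range] at ht
    have h1 := hf t (by omega)
    have hs : g ((g ^ t) x) = (g ^ (t+1)) x := by rw [pow_succ']; rfl
    rw [hs, h1]
    by_cases hlt : t + 1 < mper g x
    · rw [hf _ hlt]
      rcases Nat.even_or_odd t with he | he
      · rw [altL_even _ he, altL_odd _ he.add_one]; left; push_cast; omega
      · rw [altL_odd _ he, altL_even _ he.add_one]; right; push_cast; omega
    · have hz : (g ^ (t+1)) x = (g ^ 0) x := by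
        have : t + 1 = 0 + mper g x := by omega
        rw [this]; exact hc.per 0
      have : Odd t := by
        rw [Nat.odd_iff]; omega
      rw [hz, hf 0 (by omega), altL_odd _ this, altL_even _ (by simp)]
      right; push_cast; omega

lemma relabel1 {n : ℕ} (g : Perm (Fin n)) (x : Fin n) (hp : 2 ≤ mper g x)
    (hpar : Even (mper g x) ∨ (Odd (mper g x) ∧ ∀ y, Odd (mper g y) ∧ mper g y ≤ mper g x)) :
    ∃ f : Fin n → ℤ, Function.Injective f ∧ KK g f ≤ K0 g ∧
      (∀ t < mper g x, f ((g ^ t) x) = altL (5 * n) t) ∧ ∀ y ∉ orb g x, f y = y.val := by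
  have hn : 0 < n := by have := x.2; omega
  have := relabel (cyc_of g x) hp (fun a => (a.val : ℤ)) (fun a b h => by
      apply Fin.ext; simpa using h) Finset.univ (by simp) (by simp) (5 * n) (by omega)
      (by intro y _; have := y.2; rw [abs_of_nonneg (by omega)]; omega) (by simp)
      (hpar.imp id (fun h => ⟨h.1, fun y _ => h.2 y⟩))
  rw [← K0_eq_KK] at this
  exact this

lemma obstruct1 {n k : ℕ} {mu : Multiset ℕ} (hle : classLE n (lam n k) mu) (g : Perm (Fin n))
    (hg : Gmin n mu g) (x : Fin n) (hp : 2 ≤ mper g x)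
    (hpar : Even (mper g x) ∨ (Odd (mper g x) ∧ ∀ y, Odd (mper g y) ∧ mper g y ≤ mper g x)) :
    3 * (2 * (mper g x / 2)) ≤ 2 + 2 * mper g x := by
  classical
  obtain ⟨f, hf, hK, h1, h2⟩ := relabel1 g x hp hpar
  obtain ⟨A, _, hAc, hA⟩ := cycA g x f (5 * n) (2 * n) h1 (by omega) (by omega) hp
  have := obstruct hle g hg f hf hK (2 * n) (by omega) A hA
  rw [hAc] at this
  have hW : (Finset.univ.filter (fun a => (2 * n : ℤ) < |f a|)).card ≤ mper g x := by
    rw [← card_orb]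
    apply Finset.card_le_card
    intro a ha
    by_contra hna
    simp only [Finset.mem_filter, h2 a hna] at ha
    have := a.2
    rw [abs_of_nonneg (by omega)] at ha
    omega
  omega

lemma obstruct2 {n k : ℕ} {mu : Multiset ℕ} (hle : classLE n (lam n k) mu) (g : Perm (Fin n))
    (hg : Gmin n mu g) (x y : Fin n) (hy : y ∉ orb g x) (hp : 2 ≤ mper g x) (hq : 2 ≤ mper g y)
    (hpar : Even (mper g x) ∨ (Odd (mper g x) ∧ ∀ y, Odd (mper g y) ∧ mper g y ≤ mper g x))
    (hpar2 : Even (mper g y) ∨ (Odd (mper g y) ∧ ∀ z ∉ orb g x, Odd (mper g z) ∧ mper g z ≤ mper g y)) :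
    3 * (2 * (mper g x / 2) + 2 * (mper g y / 2)) ≤ 2 + 2 * (mper g x + mper g y) := by
  classical
  obtain ⟨f, hf, hK, h1, h2⟩ := relabel1 g x hp hpar
  have hn : 0 < n := by have := x.2; omega
  have hpn := mper_le_n g x
  have hqn := mper_le_n g y
  have hpow : ∀ t : ℕ, (g ^ t) y ∉ orb g x := by
    intro t
    rw [mem_orb, Equiv.Perm.sameCycle_pow_right, ← mem_orb]; exact hy
  obtain ⟨f', hf', hK', h1', h2'⟩ := relabel (cyc_of g y) hq f hf (orb g x)ᶜ
    (by intro z; rw [Finset.mem_compl, Finset.mem_compl, orb_mem_iff])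
    (by intro t; rw [Finset.mem_compl]; exact hpow t) (3 * n) (by omega)
    (by
      intro z hz; rw [Finset.mem_compl] at hz
      rw [h2 z hz]; have := z.2; rw [abs_of_nonneg (by omega)]; omega)
    (by
      intro z hz; simp only [Finset.mem_compl, not_not] at hz
      obtain ⟨t, ht, rfl⟩ := Finset.mem_image.mp hz
      rw [Finset.mem_range] at ht
      show _ < |f ((g ^ t) x)|
      rw [h1 t ht, altL_abs _ _ (by omega)]
      omega)
    (hpar2.imp id (fun h => ⟨h.1, fun y hy => h.2 y (by simpa using hy)⟩))
  have hdis : Disjoint (orb g x) (orb g y) := by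
    rw [Finset.disjoint_left]
    intro z hz hz'
    rw [mem_orb] at hz hz'
    exact hy ((mem_orb ..).mpr (hz.trans hz'.symm))
  have hx' : ∀ t < mper g x, f' ((g ^ t) x) = altL (5 * n) t := by
    intro t ht
    rw [h2' _ ?_, h1 t ht]
    refine Finset.disjoint_left.mp hdis ?_
    exact Finset.mem_image.mpr ⟨t, by simpa using ht, rfl⟩
  obtain ⟨A, hAs, hAc, hA⟩ := cycA g x f' (5 * n) (2 * n) hx' (by omega) (by omega) hp
  obtain ⟨A', hAs', hAc', hA'⟩ := cycA g y f' (3 * n) (2 * n) h1' (by omega) (by omega) hq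
  have := obstruct hle g hg f' hf' (hK'.trans hK) (2 * n) (by omega) (A ∪ A') (by
    intro a ha
    rcases Finset.mem_union.mp ha with h | h
    · exact hA a h
    · exact hA' a h)
  rw [Finset.card_union_of_disjoint (Finset.disjoint_of_subset_left hAs
    (Finset.disjoint_of_subset_right hAs' hdis)), hAc, hAc'] at this
  have hW : (Finset.univ.filter (fun a => (2 * n : ℤ) < |f' a|)).card ≤ mper g x + mper g y := by
    rw [← card_orb, ← card_orb]
    refine le_trans (Finset.card_le_card ?_) (Finset.card_union_le _ _)
    intro a ha
    by_contra hna
    rw [Finset.mem_union, not_or] at hna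
    simp only [Finset.mem_filter, h2' a hna.2, h2 a hna.1] at ha
    have := a.2
    rw [abs_of_nonneg (by omega)] at ha
    omega
  omega

/-- Shape of `μ`, without the length restrictions. -/
lemma shape {n k : ℕ} {mu : Multiset ℕ} (hle : classLE n (lam n k) mu) (hsum : mu.sum = n)
    (hpos : ∀ p ∈ mu, 0 < p) :
    (∀ p ∈ mu, p = 1 ∨ p = 2 ∨ p = 3 ∨ p = 5) ∧ mu.count 2 + mu.count 5 ≤ 1 := by
  classical
  obtain ⟨g, hg⟩ := exists_Gmin mu (exists_fct mu hsum hpos)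
  have hmem : ∀ x, mper g x ∈ mu := fun x => hg.1 ▸ fct_mem g x
  have hex : ∀ p ∈ mu, ∃ x, mper g x = p := fun p hp => fct_exists g p (by rw [hg.1]; exact hp)
  -- even parts are 2
  have hE : ∀ p ∈ mu, Even p → p = 2 := by
    intro p hp he
    obtain ⟨x, rfl⟩ := hex p hp
    have := hpos _ hp
    obtain ⟨q, hq⟩ := he
    have := obstruct1 hle g hg x (by omega) (Or.inl ⟨q, hq⟩)
    omega
  -- at most one 2
  have h2 : mu.count 2 ≤ 1 := by
    by_contra hcon
    obtain ⟨x, hx⟩ := hex 2 (Multiset.count_pos.mp (by omega))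
    obtain ⟨y, hy, hyx⟩ := fct_exists_two g 2 (by rw [hg.1]; omega) x hx
    have := obstruct2 hle g hg x y hyx (by omega) (by omega) (Or.inl (by rw [hx]; decide))
      (Or.inl (by rw [hy]; decide))
    omega
  by_cases hall : ∀ p ∈ mu, p ≤ 3
  · have h5 : mu.count 5 = 0 := Multiset.count_eq_zero.mpr (fun h => by have := hall 5 h; omega)
    refine ⟨fun p hp => ?_, by omega⟩
    have := hall p hp
    have := hpos p hp
    omega
  · -- pick the largest period
    push Not at hall
    obtain ⟨p0, hp0, hp0'⟩ := hall
    obtain ⟨x0, hx0⟩ := hex p0 hp0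
    obtain ⟨y, -, hymax⟩ := Finset.exists_max_image Finset.univ (mper g) ⟨x0, Finset.mem_univ _⟩
    have hy3 : 3 < mper g y := by have := hymax x0 (Finset.mem_univ _); omega
    have hyodd : Odd (mper g y) := by
      by_contra h
      have := hE _ (hmem y) (Nat.not_odd_iff_even.mp h)
      omega
    by_cases h2m : 2 ∈ mu
    · exfalso
      obtain ⟨x, hx⟩ := hex 2 h2m
      have hyx : y ∉ orb g x := fun h => by
        have := mper_of_sameCycle ((mem_orb ..).mp h)
        omega
      have := obstruct2 hle g hg x y hyx (by omega) (by omega) (Or.inl (by rw [hx]; decide))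
        (Or.inr ⟨hyodd, fun z hz => ⟨?_, hymax z (Finset.mem_univ _)⟩⟩)
      · obtain ⟨q, hq⟩ := hyodd
        omega
      · by_contra h
        have h3 := hE _ (hmem z) (Nat.not_odd_iff_even.mp h)
        have hc := count_fct g 2
        rw [hg.1] at hc
        have hlt : (insert z (orb g x)).card ≤ (Finset.univ.filter (fun y => mper g y = 2)).card := by
          apply Finset.card_le_card
          intro w hw
          rcases Finset.mem_insert.mp hw with rfl | hw
          · simpa using h3
          · have := mper_of_sameCycle ((mem_orb ..).mp hw)
            simp only [Finset.mem_filter, Finset.mem_univ, true_and]; omega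
        rw [Finset.card_insert_of_notMem hz, card_orb] at hlt
        omega
    · have hodd : ∀ z, Odd (mper g z) := by
        intro z
        by_contra h
        have h3 := hE _ (hmem z) (Nat.not_odd_iff_even.mp h)
        exact h2m (h3 ▸ hmem z)
      have hy5 : mper g y = 5 := by
        have := obstruct1 hle g hg y (by omega)
          (Or.inr ⟨hyodd, fun z => ⟨hodd z, hymax z (Finset.mem_univ _)⟩⟩)
        obtain ⟨q, hq⟩ := hyodd
        omega
      have hc2 : mu.count 2 = 0 := Multiset.count_eq_zero.mpr h2m
      constructor
      · intro p hp
        obtain ⟨x, rfl⟩ := hex p hp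
        have := hymax x (Finset.mem_univ _)
        obtain ⟨q, hq⟩ := hodd x
        omega
      · by_contra hcon
        obtain ⟨z, hz, hzy⟩ := fct_exists_two g 5 (by rw [hg.1]; omega) y hy5
        have := obstruct2 hle g hg y z hzy (by omega) (by omega)
          (Or.inr ⟨hodd y, fun z => ⟨hodd z, hymax z (Finset.mem_univ _)⟩⟩)
          (Or.inr ⟨hodd z, fun w _ => ⟨hodd w, by have := hymax w (Finset.mem_univ _); omega⟩⟩)
        omega

lemma mper_congr {n : ℕ} {g g' : Perm (Fin n)} (S : Set (Fin n)) (hS : ∀ y ∈ S, g y ∈ S)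
    (h : ∀ y ∈ S, g' y = g y) {y : Fin n} (hy : y ∈ S) : mper g' y = mper g y := by
  have key : ∀ k : ℕ, g'^[k] y = g^[k] y ∧ g^[k] y ∈ S := by
    intro k
    induction k with
    | zero => exact ⟨rfl, hy⟩
    | succ k ih =>
      rw [Function.iterate_succ_apply', Function.iterate_succ_apply', ih.1, h _ ih.2]
      exact ⟨rfl, hS _ ih.2⟩
  have hiff : ∀ k, Function.IsPeriodicPt g' k y ↔ Function.IsPeriodicPt g k y := by
    intro k
    unfold Function.IsPeriodicPt Function.IsFixedPt
    rw [(key k).1]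
  apply Nat.dvd_antisymm
  · rw [← Function.isPeriodicPt_iff_minimalPeriod_dvd, hiff]
    exact Function.isPeriodicPt_minimalPeriod _ _
  · rw [← Function.isPeriodicPt_iff_minimalPeriod_dvd, ← hiff]
    exact Function.isPeriodicPt_minimalPeriod _ _

lemma mper_two {n : ℕ} {g : Perm (Fin n)} {x : Fin n} (h : g (g x) = x) (h1 : g x ≠ x) : mper g x = 2 :=
  haveI := Fact.mk Nat.prime_two
  Function.minimalPeriod_eq_prime (p := 2) h h1

lemma mper_three {n : ℕ} {g : Perm (Fin n)} {x : Fin n} (h : g (g (g x)) = x) (h1 : g x ≠ x) :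
    mper g x = 3 :=
  haveI := Fact.mk Nat.prime_three
  Function.minimalPeriod_eq_prime (p := 3) h h1

lemma mper_five {n : ℕ} {g : Perm (Fin n)} {x : Fin n} (h : g (g (g (g (g x)))) = x) (h1 : g x ≠ x) :
    mper g x = 5 :=
  haveI := Fact.mk Nat.prime_five
  Function.minimalPeriod_eq_prime (p := 5) h h1

/-- a lower bound -/
lemma lower_aux {n : ℕ} (g : Perm (Fin n)) (O : Finset (Fin n)) (hO : ∀ y, g y ∈ O ↔ y ∈ O)
    (h3 : ∀ y ∈ O, g (g (g y)) = y) :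
    O.card ^ 2 + 2 * O.card + 2 * (O.filter (fun y => g y = y)).card ^ 2 ≤
      3 * (∑ a ∈ O, ∑ b ∈ O, if (a < b ↔ g a < g b) then 1 else 0)
        + 2 * (O.filter (fun y => g y = y)).card := by
  classical
  set e : Fin n → Fin n → ℕ := fun a b => if (a < b ↔ g a < g b) then 1 else 0 with he
  have hperm : ∀ u : Fin n → ℕ, ∑ a ∈ O, u (g a) = ∑ a ∈ O, u a := by
    intro u
    apply Finset.sum_bij (fun a _ => g a)
    · intro a ha; exact (hO a).mpr ha
    · intro a _ b _ h; exact g.injective h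
    · intro b hb; exact ⟨g⁻¹ b, by rw [← hO]; simpa using hb, by simp⟩
    · intro a _; rfl
  have s1 : ∑ a ∈ O, ∑ b ∈ O, e (g a) (g b) = ∑ a ∈ O, ∑ b ∈ O, e a b := by
    rw [hperm (fun a => ∑ b ∈ O, e a (g b))]
    exact Finset.sum_congr rfl fun a _ => hperm (fun b => e a b)
  have s2 : ∑ a ∈ O, ∑ b ∈ O, e (g (g a)) (g (g b)) = ∑ a ∈ O, ∑ b ∈ O, e a b := by
    rw [← s1, hperm (fun a => ∑ b ∈ O, e (g a) (g (g b)))]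
    exact Finset.sum_congr rfl fun a _ => hperm (fun b => e (g a) (g b))
  set fx : Fin n → ℕ := fun a => if g a = a then 1 else 0 with hfx
  have hpt : ∀ a ∈ O, ∀ b ∈ O, 1 + 2 * (fx a * fx b) + 2 * (if a = b then 1 else 0)
      ≤ (e a b + e (g a) (g b) + e (g (g a)) (g (g b))) + 2 * (if a = b then fx a else 0) := by
    intro a ha b hb
    have ea := h3 a ha
    have eb := h3 b hb
    by_cases hab : a = b
    · subst hab
      simp only [he, hfx]
      by_cases hga : g a = a <;> simp [hga]
    · by_cases hga : g a = a
      · by_cases hgb : g b = b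
        · simp [he, hfx, hga, hgb, hab]
        · simp only [he, hfx, hga, hgb, hab, ea, eb, if_true, if_false]
          split_ifs <;> first | omega | (exfalso; tauto)
      · simp only [he, hfx, hga, hab, ea, eb, if_true, if_false]
        split_ifs <;> first | omega | (exfalso; tauto)
  have hsum := Finset.sum_le_sum fun a ha => Finset.sum_le_sum (hpt a ha)
  simp only [Finset.sum_add_distrib, ← Finset.mul_sum] at hsum
  have t1 : ∑ a ∈ O, ∑ b ∈ O, 1 = O.card ^ 2 := by simp [sq]
  have tf : ∑ a ∈ O, fx a = (O.filter (fun y => g y = y)).card := by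
    rw [Finset.card_filter]
  have t2 : ∑ a ∈ O, fx a * ∑ b ∈ O, fx b = (O.filter (fun y => g y = y)).card ^ 2 := by
    rw [← Finset.sum_mul, tf, sq]
  have t3 : ∑ a ∈ O, ∑ b ∈ O, (if a = b then 1 else 0) = O.card := by
    rw [Finset.card_eq_sum_ones]
    refine Finset.sum_congr rfl fun a ha => ?_
    rw [Finset.sum_ite_eq]; simp [ha]
  have t4 : ∑ a ∈ O, ∑ b ∈ O, (if a = b then fx a else 0) = (O.filter (fun y => g y = y)).card := by
    rw [← tf]
    refine Finset.sum_congr rfl fun a ha => ?_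
    rw [Finset.sum_ite_eq]; simp [ha]
  rw [t1, t2, t3, t4] at hsum
  have s0 : ∑ a ∈ O, ∑ b ∈ O, (if (a < b ↔ g a < g b) then 1 else 0) = ∑ a ∈ O, ∑ b ∈ O, e a b := rfl
  omega

lemma fix_card {n l : ℕ} {g : Perm (Fin n)} (hg : fullCycleType n g = lam n l) :
    (Finset.univ.filter (fun y => g y = y)).card = n - 2 - 3 * l := by
  have hc := count_fct g 1
  rw [hg, lam_count] at hc
  simp only [mper_one_iff] at hc
  rw [← hc]; norm_num

/-- attaining the lower bound -/
def Tight (n l : ℕ) (g : Perm (Fin n)) : Prop :=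
  fullCycleType n g = lam n l ∧
    3 * K0 g + 2 * (n - 2 - 3 * l) = 6 + (n - 2) ^ 2 + 2 * (n - 2) + 2 * (n - 2 - 3 * l) ^ 2

lemma lam_lower {n l : ℕ} {g : Perm (Fin n)} (hg : fullCycleType n g = lam n l) :
    6 + (n - 2) ^ 2 + 2 * (n - 2) + 2 * (n - 2 - 3 * l) ^ 2 ≤ 3 * K0 g + 2 * (n - 2 - 3 * l) := by
  classical
  obtain ⟨x, hx, hne, hxx, h3⟩ := lam_struct hg
  have hO : ∀ y, g y ∈ ({x, g x} : Finset (Fin n))ᶜ ↔ y ∈ ({x, g x} : Finset (Fin n))ᶜ := by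
    intro y
    simp only [Finset.mem_compl, Finset.mem_insert, Finset.mem_singleton, g.injective.eq_iff]
    have : g y = x ↔ y = g x := by
      constructor
      · rintro rfl
        exact g.injective hxx.symm
      · rintro rfl; exact hxx
    tauto
  have hl := lower_aux g ({x, g x} : Finset (Fin n))ᶜ hO (fun y hy => by
    simp only [Finset.mem_compl, Finset.mem_insert, Finset.mem_singleton, not_or] at hy
    exact h3 y hy.1 hy.2)
  have hc : (({x, g x} : Finset (Fin n))ᶜ).card = n - 2 := by
    rw [Finset.card_compl, Finset.card_pair hne.symm, Fintype.card_fin]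
  have hfx : (({x, g x} : Finset (Fin n))ᶜ.filter (fun y => g y = y)) = Finset.univ.filter (fun y => g y = y) := by
    ext y
    simp only [Finset.mem_filter, Finset.mem_compl, Finset.mem_insert, Finset.mem_singleton,
      Finset.mem_univ, true_and, and_iff_right_iff_imp]
    rintro hy (rfl | rfl)
    · exact hne hy
    · exact hne (g.injective hy)
  rw [hc, hfx, fix_card hg] at hl
  have hK : 2 + ∑ a ∈ ({x, g x} : Finset (Fin n))ᶜ, ∑ b ∈ ({x, g x} : Finset (Fin n))ᶜ,
      (if (a < b ↔ g a < g b) then 1 else 0) ≤ K0 g := by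
    unfold K0 KK
    simp only [id]
    rw [sum_sum_pair hne.symm (fun a b => if (a < b ↔ g a < g b) then 1 else 0)]
    simp
    omega
  omega

lemma Tight.gmin {n l : ℕ} {g : Perm (Fin n)} (h : Tight n l g) : Gmin n (lam n l) g := by
  refine ⟨h.1, fun g' hg' => ?_⟩
  have := lam_lower hg'
  have := h.2
  omega

lemma lam_step {n l : ℕ} {g : Perm (Fin n)} (h : Tight n l g) (hl : 3 * (l + 1) + 2 ≤ n) :
    ∃ g', Relation.ReflTransGen Raise g g' ∧ Tight n (l + 1) g' ∧ (∀ y, g y ≠ y → g' y = g y) ∧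
      (∀ y, g y = y → (∀ z, g z = z → y ≤ z) → g' y ≠ y) := by
  classical
  obtain ⟨hty, hK⟩ := h
  set Fx := Finset.univ.filter (fun y => g y = y) with hFx
  have hmem : ∀ y, y ∈ Fx ↔ g y = y := by simp [hFx]
  have hcard : Fx.card = n - 2 - 3 * l := fix_card hty
  have hne : Fx.Nonempty := Finset.card_pos.mp (by omega)
  set a := Fx.min' hne with ha
  set c := Fx.max' hne with hc
  have haF : a ∈ Fx := Finset.min'_mem _ _
  have hcF : c ∈ Fx := Finset.max'_mem _ _
  obtain ⟨b, hb⟩ : ((Fx.erase a).erase c).Nonempty := by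
    apply Finset.card_pos.mp
    have := Finset.pred_card_le_card_erase (s := Fx) (a := a)
    have := Finset.pred_card_le_card_erase (s := Fx.erase a) (a := c)
    omega
  obtain ⟨hbc, hb⟩ := Finset.mem_erase.mp hb
  obtain ⟨hba, hbF⟩ := Finset.mem_erase.mp hb
  have hab : a < b := lt_of_le_of_ne (Finset.min'_le _ _ hbF) hba.symm
  have hbc : b < c := lt_of_le_of_ne (Finset.le_max' _ _ hbF) hbc
  have ga := (hmem a).mp haF
  have gb := (hmem b).mp hbF
  have gc := (hmem c).mp hcF
  have hac : a < c := hab.trans hbc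
  set g1 := g * swap a b with hg1
  set g2 := g1 * swap a c with hg2
  have g1a : g1 a = b := by simp [hg1, gb]
  have g1b : g1 b = a := by simp [hg1, ga]
  have g1y : ∀ y, y ≠ a → y ≠ b → g1 y = g y := fun y h1 h2 => by
    simp [hg1, swap_apply_of_ne_of_ne h1 h2]
  have g1c : g1 c = c := by rw [g1y c hac.ne' hbc.ne', gc]
  have g2a : g2 a = c := by simp [hg2, g1c]
  have g2c : g2 c = b := by simp [hg2, g1a]
  have g2b : g2 b = a := by
    rw [hg2, Perm.mul_apply, swap_apply_of_ne_of_ne hab.ne' hbc.ne, g1b]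
  have g2y : ∀ y, y ≠ a → y ≠ b → y ≠ c → g2 y = g y := fun y h1 h2 h3 => by
    rw [hg2, Perm.mul_apply, swap_apply_of_ne_of_ne h1 h3, g1y y h1 h2]
  have r1 : Raise g g1 := ⟨a, b, hab, by rw [ga, gb]; exact hab, rfl⟩
  have r2 : Raise g1 g2 := ⟨a, c, hac, by rw [g1a, g1c]; exact hbc, rfl⟩
  -- cycle type
  have hmp : ∀ y, y ≠ a → y ≠ b → y ≠ c → mper g2 y = mper g y := by
    intro y h1 h2 h3
    apply mper_congr {y | y ≠ a ∧ y ≠ b ∧ y ≠ c} _ _ (show y ∈ _ from ⟨h1, h2, h3⟩)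
    · rintro y ⟨h1, h2, h3⟩
      refine ⟨fun h => h1 ?_, fun h => h2 ?_, fun h => h3 ?_⟩
      · rw [← ga] at h; exact g.injective h
      · rw [← gb] at h; exact g.injective h
      · rw [← gc] at h; exact g.injective h
    · rintro y ⟨h1, h2, h3⟩; exact g2y y h1 h2 h3
  have ma : mper g2 a = 3 := mper_three (by rw [g2a, g2c, g2b]) (by rw [g2a]; exact hac.ne')
  have mb : mper g2 b = 3 := mper_three (by rw [g2b, g2a, g2c]) (by rw [g2b]; exact hab.ne)
  have mc : mper g2 c = 3 := mper_three (by rw [g2c, g2b, g2a]) (by rw [g2c]; exact hbc.ne)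
  have ma1 : mper g a = 1 := (mper_one_iff g a).mpr ga
  have mb1 : mper g b = 1 := (mper_one_iff g b).mpr gb
  have mc1 : mper g c = 1 := (mper_one_iff g c).mpr gc
  have hS : ({a, b, c} : Finset (Fin n)).card = 3 := Finset.card_eq_three.mpr
    ⟨a, b, c, hab.ne, hac.ne, hbc.ne, rfl⟩
  have hty2 : fullCycleType n g2 = lam n (l + 1) := by
    rw [fct_eq_iff _ _ (by rw [lam_count]; simp)]
    intro p
    have e0 := (fct_eq_iff g _ (by rw [lam_count]; simp)).mp hty p
    have split : ∀ (h : Perm (Fin n)), (Finset.univ.filter (fun y => mper h y = p)).card =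
        (({a, b, c} : Finset (Fin n)).filter (fun y => mper h y = p)).card +
        ((({a, b, c} : Finset (Fin n))ᶜ).filter (fun y => mper h y = p)).card := by
      intro h
      rw [← Finset.card_union_of_disjoint, ← Finset.filter_union, Finset.union_compl]
      exact Finset.disjoint_filter_filter disjoint_compl_right
    rw [split] at e0 ⊢
    have e1 : ((({a, b, c} : Finset (Fin n))ᶜ).filter (fun y => mper g2 y = p)) =
        ((({a, b, c} : Finset (Fin n))ᶜ).filter (fun y => mper g y = p)) := by
      apply Finset.filter_congr
      intro y hy
      simp only [Finset.mem_compl, Finset.mem_insert, Finset.mem_singleton, not_or] at hy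
      rw [hmp y hy.1 hy.2.1 hy.2.2]
    have e2 : (({a, b, c} : Finset (Fin n)).filter (fun y => mper g y = p)).card = if p = 1 then 3 else 0 := by
      have : (({a, b, c} : Finset (Fin n)).filter (fun y => mper g y = p)) =
          (({a, b, c} : Finset (Fin n)).filter (fun y => p = 1)) := by
        apply Finset.filter_congr
        intro y hy
        simp only [Finset.mem_insert, Finset.mem_singleton] at hy
        rcases hy with rfl | rfl | rfl <;> omega
      rw [this]
      split_ifs with h <;> simp [h, hS]
    have e3 : (({a, b, c} : Finset (Fin n)).filter (fun y => mper g2 y = p)).card = if p = 3 then 3 else 0 := by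
      have : (({a, b, c} : Finset (Fin n)).filter (fun y => mper g2 y = p)) =
          (({a, b, c} : Finset (Fin n)).filter (fun y => p = 3)) := by
        apply Finset.filter_congr
        intro y hy
        simp only [Finset.mem_insert, Finset.mem_singleton] at hy
        rcases hy with rfl | rfl | rfl <;> omega
      rw [this]
      split_ifs with h <;> simp [h, hS]
    rw [e1, e3]
    rw [e2] at e0
    rw [lam_count] at e0 ⊢
    by_cases h1 : p = 1
    · subst h1; norm_num at e0 ⊢; omega
    · by_cases h2 : p = 2
      · subst h2; norm_num at e0 ⊢; omega
      · by_cases h3 : p = 3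
        · subst h3; norm_num at e0 ⊢; omega
        · simp [h1, h2, h3] at e0 ⊢; exact e0
  -- length
  have k1 := K0_swap g hab (by rw [ga, gb]; exact hab)
  have k2 := K0_swap g1 hac (by rw [g1a, g1c]; exact hbc)
  rw [← hg1, ga, gb] at k1
  rw [← hg2, g1a, g1c] at k2
  have c1 : (Fx.filter (fun x => a < x ∧ x < b)).card ≤
      (Finset.univ.filter (fun x => a < x ∧ x < b ∧ a < g x ∧ g x < b)).card := by
    apply Finset.card_le_card
    intro y hy
    obtain ⟨hyF, h1, h2⟩ := Finset.mem_filter.mp hy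
    rw [hmem] at hyF
    simp only [Finset.mem_filter, Finset.mem_univ, true_and, hyF]
    exact ⟨h1, h2, h1, h2⟩
  have c2 : (Fx.filter (fun x => b < x ∧ x < c)).card ≤
      (Finset.univ.filter (fun x => a < x ∧ x < c ∧ b < g1 x ∧ g1 x < c)).card := by
    apply Finset.card_le_card
    intro y hy
    obtain ⟨hyF, h1, h2⟩ := Finset.mem_filter.mp hy
    rw [hmem] at hyF
    simp only [Finset.mem_filter, Finset.mem_univ, true_and, g1y y (hab.trans h1).ne' h1.ne', hyF]
    exact ⟨hab.trans h1, h2, h1, h2⟩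
  have c3 : Fx.card ≤ 3 + ((Fx.filter (fun x => a < x ∧ x < b)).card +
      (Fx.filter (fun x => b < x ∧ x < c)).card) := by
    rw [← hS]
    refine le_trans (Finset.card_le_card ?_) (le_trans (Finset.card_union_le _ _)
      (Nat.add_le_add_left (Finset.card_union_le _ _) _))
    intro y hy
    have h1 : a ≤ y := Finset.min'_le _ _ hy
    have h2 : y ≤ c := Finset.le_max' _ _ hy
    simp only [Finset.mem_union, Finset.mem_insert, Finset.mem_singleton, Finset.mem_filter, hy, true_and]
    rcases lt_trichotomy y b with h | h | h
    · rcases h1.eq_or_lt with h' | h'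
      · simp [h']
      · simp [h, h']
    · simp [h]
    · rcases h2.eq_or_lt with h' | h'
      · simp [h']
      · simp [h, h']
  have hlow := lam_lower hty2
  obtain ⟨m, hm⟩ : ∃ m, n - 2 - 3 * l = m + 3 := ⟨n - 2 - 3 * l - 3, by omega⟩
  have hm' : n - 2 - 3 * (l + 1) = m := by omega
  have hKle : 3 * K0 g2 + 2 * m ≤ 6 + (n - 2) ^ 2 + 2 * (n - 2) + 2 * m ^ 2 := by
    rw [hm] at hK hcard
    have : (m + 3) ^ 2 = m ^ 2 + 6 * m + 9 := by ring
    omega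
  refine ⟨g2, (Relation.ReflTransGen.single r1).tail r2, ⟨hty2, ?_⟩, ?_, ?_⟩
  · rw [hm'] at hlow ⊢; omega
  · intro y hy
    apply g2y
    · rintro rfl; exact hy ga
    · rintro rfl; exact hy gb
    · rintro rfl; exact hy gc
  · intro y hy hz
    have : y = a := le_antisymm (hz a ga) (Finset.min'_le _ _ ((hmem y).mpr hy))
    rw [this, g2a]; exact hac.ne'

lemma lam_chain {n l : ℕ} {g : Perm (Fin n)} (h : Tight n l g) (d : ℕ) (hl : 3 * (l + d) + 2 ≤ n) :
    ∃ g', Relation.ReflTransGen Raise g g' ∧ Tight n (l + d) g' ∧ (∀ y, g y ≠ y → g' y = g y) := by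
  induction d with
  | zero => exact ⟨g, .refl, h, fun _ _ => rfl⟩
  | succ d ih =>
    obtain ⟨g1, h1, h2, h3⟩ := ih (by omega)
    obtain ⟨g2, h4, h5, h6, _⟩ := lam_step h2 (by omega)
    refine ⟨g2, h1.trans h4, h5, fun y hy => ?_⟩
    have e := h3 y hy
    rw [h6 y (by rw [e]; exact hy), e]

/-- the partition `(5, 3^l, 1^{n-5-3l})` -/
abbrev nu (n l : ℕ) : Multiset ℕ :=
  5 ::ₘ (Multiset.replicate l 3 + Multiset.replicate (n - 5 - 3 * l) 1)

lemma nu_count (n l p : ℕ) : (nu n l).count p =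
    (if p = 3 then l else 0) + (if p = 5 then 1 else 0) + (if p = 1 then n - 5 - 3 * l else 0) := by
  unfold nu
  rw [Multiset.count_cons, Multiset.count_add, Multiset.count_replicate, Multiset.count_replicate]
  split_ifs <;> omega

lemma filt_const {n : ℕ} (S : Finset (Fin n)) (h : Perm (Fin n)) (q p : ℕ)
    (hS : ∀ y ∈ S, mper h y = q) :
    (S.filter (fun y => mper h y = p)).card = if p = q then S.card else 0 := by
  classical
  have : S.filter (fun y => mper h y = p) = S.filter (fun _ => p = q) := by
    apply Finset.filter_congr
    intro y hy
    have := hS y hy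
    omega
  rw [this]
  split_ifs with hh <;> simp [hh]

lemma split5 {n l : ℕ} (g : Perm (Fin n)) (u0 u1 u2 u3 u4 : Fin n)
    (h0 : g u0 = u1) (h1 : g u1 = u2) (h2 : g u2 = u3) (h3 : g u3 = u4) (h4 : g u4 = u0)
    (d01 : u0 ≠ u1) (d02 : u0 ≠ u2) (d03 : u0 ≠ u3) (d04 : u0 ≠ u4) (d12 : u1 ≠ u2)
    (d13 : u1 ≠ u3) (d14 : u1 ≠ u4) (d23 : u2 ≠ u3) (d24 : u2 ≠ u4) (d34 : u3 ≠ u4) :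
    fullCycleType n (g * swap u0 u2) = lam n (l + 1) ↔ fullCycleType n g = nu n l := by
  classical
  set h := g * swap u0 u2 with hh
  have k0 : h u0 = u3 := by simp [hh, h2]
  have k2 : h u2 = u1 := by simp [hh, h0]
  have ky : ∀ y, y ≠ u0 → y ≠ u2 → h y = g y := fun y e1 e2 => by
    simp [hh, swap_apply_of_ne_of_ne e1 e2]
  have k1 : h u1 = u2 := by rw [ky _ d01.symm d12, h1]
  have k3 : h u3 = u4 := by rw [ky _ d03.symm d23.symm, h3]
  have k4 : h u4 = u0 := by rw [ky _ d04.symm d24.symm, h4]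
  set S3 : Finset (Fin n) := {u0, u3, u4} with hS3
  set S2 : Finset (Fin n) := {u1, u2} with hS2
  have c3 : S3.card = 3 := Finset.card_eq_three.mpr ⟨u0, u3, u4, d03, d04, d34, rfl⟩
  have c2 : S2.card = 2 := Finset.card_pair d12
  have hdis : Disjoint S3 S2 := by
    rw [Finset.disjoint_left]
    intro y hy
    simp only [hS3, hS2, Finset.mem_insert, Finset.mem_singleton] at hy ⊢
    rcases hy with rfl | rfl | rfl
    · simp [d01, d02]
    · simp [d13.symm, d23.symm]
    · simp [d14.symm, d24.symm]
  have m3 : ∀ y ∈ S3, mper h y = 3 := by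
    intro y hy
    simp only [hS3, Finset.mem_insert, Finset.mem_singleton] at hy
    rcases hy with rfl | rfl | rfl <;> apply mper_three
    · rw [k0, k3, k4]
    · rw [k0]; exact d03.symm
    · rw [k3, k4, k0]
    · rw [k3]; exact d34.symm
    · rw [k4, k0, k3]
    · rw [k4]; exact d04
  have m2 : ∀ y ∈ S2, mper h y = 2 := by
    intro y hy
    simp only [hS2, Finset.mem_insert, Finset.mem_singleton] at hy
    rcases hy with rfl | rfl <;> apply mper_two
    · rw [k1, k2]
    · rw [k1]; exact d12.symm
    · rw [k2, k1]
    · rw [k2]; exact d12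
  have hmem : ∀ y, y ∈ S3 ∪ S2 ↔ y = u0 ∨ y = u1 ∨ y = u2 ∨ y = u3 ∨ y = u4 := by
    intro y
    simp only [hS3, hS2, Finset.mem_union, Finset.mem_insert, Finset.mem_singleton]; tauto
  have m5 : ∀ y ∈ S3 ∪ S2, mper g y = 5 := by
    intro y hy
    rw [hmem] at hy
    rcases hy with rfl | rfl | rfl | rfl | rfl <;> apply mper_five
    · rw [h0, h1, h2, h3, h4]
    · rw [h0]; exact d01.symm
    · rw [h1, h2, h3, h4, h0]
    · rw [h1]; exact d12.symm
    · rw [h2, h3, h4, h0, h1]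
    · rw [h2]; exact d23.symm
    · rw [h3, h4, h0, h1, h2]
    · rw [h3]; exact d34.symm
    · rw [h4, h0, h1, h2, h3]
    · rw [h4]; exact d04
  have mo : ∀ y ∈ (S3 ∪ S2)ᶜ, mper h y = mper g y := by
    intro y hy
    apply mper_congr {y | y ∉ S3 ∪ S2} _ _ (show y ∈ _ from by simpa using hy)
    · intro y hy hgy
      simp only [Set.mem_ofPred_eq, hmem] at hy hgy
      have inj : ∀ a, g y = g a → y = a := fun a e => g.injective e
      rcases hgy with e | e | e | e | e
      · have := inj u4 (e.trans h4.symm); tauto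
      · have := inj u0 (e.trans h0.symm); tauto
      · have := inj u1 (e.trans h1.symm); tauto
      · have := inj u2 (e.trans h2.symm); tauto
      · have := inj u3 (e.trans h3.symm); tauto
    · intro y hy
      simp only [Set.mem_ofPred_eq, hmem] at hy
      exact ky y (by tauto) (by tauto)
  rw [fct_eq_iff _ _ (by rw [lam_count]; simp), fct_eq_iff _ _ (by rw [nu_count]; simp)]
  apply forall_congr'
  intro p
  have split : ∀ (h : Perm (Fin n)), (Finset.univ.filter (fun y => mper h y = p)).card =
      ((S3 ∪ S2).filter (fun y => mper h y = p)).card +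
      (((S3 ∪ S2)ᶜ).filter (fun y => mper h y = p)).card := by
    intro h
    rw [← Finset.card_union_of_disjoint, ← Finset.filter_union, Finset.union_compl]
    exact Finset.disjoint_filter_filter disjoint_compl_right
  have e1 : (((S3 ∪ S2)ᶜ).filter (fun y => mper h y = p)) =
      (((S3 ∪ S2)ᶜ).filter (fun y => mper g y = p)) := by
    apply Finset.filter_congr
    intro y hy
    rw [mo y hy]
  have e2 : ((S3 ∪ S2).filter (fun y => mper h y = p)).card =
      (if p = 3 then 3 else 0) + (if p = 2 then 2 else 0) := by
    rw [Finset.filter_union, Finset.card_union_of_disjoint (Finset.disjoint_filter_filter hdis),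
      filt_const S3 h 3 p m3, filt_const S2 h 2 p m2, c3, c2]
  have e3 := filt_const (S3 ∪ S2) g 5 p m5
  rw [Finset.card_union_of_disjoint hdis, c3, c2] at e3
  rw [split h, split g, e1, e2, e3, lam_count, nu_count]
  have hsub : n - 2 - 3 * (l + 1) = n - 5 - 3 * l := by omega
  rw [hsub]
  by_cases q1 : p = 1
  · subst q1; norm_num
  · by_cases q2 : p = 2
    · subst q2; norm_num
    · by_cases q3 : p = 3
      · subst q3; norm_num; omega
      · by_cases q5 : p = 5
        · subst q5; norm_num
        · simp [q1, q2, q3, q5]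

lemma base {n : ℕ} (hn : 2 ≤ n) : Tight n 0 (swap (⟨0, by omega⟩ : Fin n) ⟨n - 1, by omega⟩) := by
  classical
  have hlt : (⟨0, by omega⟩ : Fin n) < ⟨n - 1, by omega⟩ := by
    rw [Fin.lt_def]; show 0 < n - 1; omega
  constructor
  · have : (swap (⟨0, by omega⟩ : Fin n) ⟨n - 1, by omega⟩).cycleType = {2} :=
      Equiv.Perm.isSwap_iff_cycleType.mp ⟨_, _, hlt.ne, rfl⟩
    unfold fullCycleType lam
    rw [this]; simp
  · have k := K0_swap (1 : Perm (Fin n)) hlt hlt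
    have hc : (Finset.univ.filter (fun x : Fin n => ⟨0, by omega⟩ < x ∧ x < ⟨n - 1, by omega⟩ ∧
        (1 : Perm (Fin n)) ⟨0, by omega⟩ < (1 : Perm (Fin n)) x ∧
        (1 : Perm (Fin n)) x < (1 : Perm (Fin n)) ⟨n - 1, by omega⟩)).card = n - 2 := by
      have : (Finset.univ.filter (fun x : Fin n => ⟨0, by omega⟩ < x ∧ x < ⟨n - 1, by omega⟩ ∧
        (1 : Perm (Fin n)) ⟨0, by omega⟩ < (1 : Perm (Fin n)) x ∧
        (1 : Perm (Fin n)) x < (1 : Perm (Fin n)) ⟨n - 1, by omega⟩))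
         = ({⟨0, by omega⟩, ⟨n - 1, by omega⟩} : Finset (Fin n))ᶜ := by
        ext y
        have := y.2
        simp only [Finset.mem_filter, Finset.mem_univ, true_and, Perm.one_apply, Finset.mem_compl,
          Finset.mem_insert, Finset.mem_singleton, Fin.lt_def, Fin.ext_iff]
        omega
      rw [this, Finset.card_compl, Finset.card_pair hlt.ne, Fintype.card_fin]
    rw [K0_one, hc, one_mul] at k
    obtain ⟨s, rfl⟩ : ∃ s, n = s + 2 := ⟨n - 2, by omega⟩
    have e : (s + 2) * (s + 2) = s ^ 2 + 4 * s + 4 := by ring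
    rw [e] at k
    have e2 : s + 2 - 2 = s := by omega
    simp only [e2, mul_zero, Nat.sub_zero] at k ⊢
    omega

lemma lam_exists {n l : ℕ} (hl : 3 * l + 2 ≤ n) : ∃ h : Perm (Fin n), Tight n l h := by
  obtain ⟨g, _, h, _⟩ := lam_chain (base (n := n) (by omega)) l (by omega)
  exact ⟨g, by simpa using h⟩

lemma lam_exists' {n l : ℕ} (hl : 3 * (l + 1) + 2 ≤ n) : ∃ h : Perm (Fin n), Tight n (l + 1) h ∧
    h ⟨0, by omega⟩ = ⟨n - 1, by omega⟩ ∧ h ⟨n - 1, by omega⟩ = ⟨0, by omega⟩ ∧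
    h ⟨1, by omega⟩ ≠ ⟨1, by omega⟩ := by
  have hlt : (⟨0, by omega⟩ : Fin n) ≠ ⟨n - 1, by omega⟩ := by
    rw [Ne, Fin.ext_iff]; show ¬ 0 = n - 1; omega
  have b0 := base (n := n) (by omega)
  set s := swap (⟨0, by omega⟩ : Fin n) ⟨n - 1, by omega⟩ with hs
  have s0 : s ⟨0, by omega⟩ = ⟨n - 1, by omega⟩ := by simp [hs]
  have st : s ⟨n - 1, by omega⟩ = ⟨0, by omega⟩ := by simp [hs]
  have s1 : s ⟨1, by omega⟩ = ⟨1, by omega⟩ := by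
    apply swap_apply_of_ne_of_ne
    · simp
    · rw [Ne, Fin.ext_iff]; show ¬ 1 = n - 1; omega
  obtain ⟨g1, _, h1, h2, h3⟩ := lam_step b0 (by omega)
  obtain ⟨g2, _, h4, h5⟩ := lam_chain h1 l (by omega)
  have e0 : g1 ⟨0, by omega⟩ = ⟨n - 1, by omega⟩ := by rw [h2 _ (by rw [s0]; exact hlt.symm), s0]
  have et : g1 ⟨n - 1, by omega⟩ = ⟨0, by omega⟩ := by rw [h2 _ (by rw [st]; exact hlt), st]
  have e1 : g1 ⟨1, by omega⟩ ≠ ⟨1, by omega⟩ := by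
    apply h3 _ s1
    intro z hz
    rw [Fin.le_def]
    by_contra hcon
    have : z = ⟨0, by omega⟩ := by
      apply Fin.ext
      have : z.val < 1 := not_le.mp hcon
      show z.val = 0
      omega
    rw [this, s0] at hz
    exact hlt hz.symm
  refine ⟨g2, ?_, ?_, ?_, ?_⟩
  · have : 0 + 1 + l = l + 1 := by omega
    rw [this] at h4; exact h4
  · rw [h5 _ (by rw [e0]; exact hlt.symm), e0]
  · rw [h5 _ (by rw [et]; exact hlt), et]
  · rw [h5 _ e1]; exact e1

lemma gmin_tight {n l : ℕ} (hl : 3 * l + 2 ≤ n) {g : Perm (Fin n)} (h : Gmin n (lam n l) g) :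
    Tight n l g := by
  obtain ⟨h0, hh⟩ := lam_exists hl
  have := h.2 h0 hh.1
  have := lam_lower h.1
  have := hh.2
  exact ⟨h.1, by omega⟩

/-- an upper bound for the minimal length in the class of `(5,3^l,1^m)` -/
lemma nu_upper {n l : ℕ} (hl : 3 * (l + 1) + 2 ≤ n) : ∃ h g : Perm (Fin n), Tight n (l + 1) h ∧
    fullCycleType n g = nu n l ∧ K0 g = K0 h + 2 := by
  classical
  obtain ⟨h, hT, h0, ht, h1⟩ := lam_exists' hl
  set z : Fin n := ⟨0, by omega⟩ with hz
  set t : Fin n := ⟨n - 1, by omega⟩ with htt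
  set o : Fin n := ⟨1, by omega⟩ with ho
  have dzt : z ≠ t := by rw [Ne, Fin.ext_iff]; show ¬ 0 = n - 1; omega
  have doz : o ≠ z := by rw [Ne, Fin.ext_iff]; show ¬ 1 = 0; omega
  have dot : o ≠ t := by rw [Ne, Fin.ext_iff]; show ¬ 1 = n - 1; omega
  have ij : ∀ {a b}, h a = h b → a = b := fun e => h.injective e
  set p := h o with hp
  set v := h p with hv
  have dpz : p ≠ z := fun e => dot (ij (e.trans ht.symm))
  have dpt : p ≠ t := fun e => doz (ij (e.trans h0.symm))
  have dvz : v ≠ z := fun e => dpt (ij (e.trans ht.symm))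
  have dvt : v ≠ t := fun e => dpz (ij (e.trans h0.symm))
  have dvp : v ≠ p := fun e => h1 (ij e)
  have hvo : h v = o := by
    obtain ⟨x, _, _, hxx, h3⟩ := lam_struct hT.1
    apply h3
    all_goals
      have hx : z = x ∨ z = h x := by
        by_contra hcon
        push Not at hcon
        have := h3 z hcon.1 hcon.2
        rw [h0, ht, h0] at this
        exact dzt this.symm
      rcases hx with hx | hx
      · rw [← hx]; first | exact doz | (rw [h0]; exact dot)
      · have : x = t := ij (hx.symm.trans ht.symm)
        rw [this]; first | exact dot | (rw [ht]; exact doz)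
  have dvo : v ≠ o := fun e => h1 (by rw [e] at hvo; exact hvo)
  set g := h * swap v t with hg
  have gv : g v = z := by simp [hg, ht]
  have gt : g t = o := by simp [hg, hvo]
  have gy : ∀ y, y ≠ v → y ≠ t → g y = h y := fun y e1 e2 => by
    simp [hg, swap_apply_of_ne_of_ne e1 e2]
  have hback : g * swap v t = h := by simp [hg, mul_assoc]
  have hlt : v < t := by
    refine lt_of_le_of_ne ?_ dvt
    rw [Fin.le_def]; show v.val ≤ n - 1; have := v.2; omega
  refine ⟨h, g, hT, ?_, ?_⟩
  · rw [← split5 g v z t o p gv (by rw [gy z dvz.symm dzt, h0]) gt (gy o dvo.symm dot)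
      (gy p dvp.symm dpt) dvz dvt dvo dvp dzt doz.symm dpz.symm dot.symm dpt.symm h1.symm, hback]
    exact hT.1
  · have hlt' : g v < g t := by rw [gv, gt]; rw [Fin.lt_def]; show 0 < 1; omega
    have k := K0_swap g hlt hlt'
    rw [hback, gv, gt] at k
    have : (Finset.univ.filter (fun x => v < x ∧ x < t ∧ z < g x ∧ g x < o)) = ∅ := by
      apply Finset.filter_eq_empty_iff.mpr
      rintro y - ⟨_, _, e1, e2⟩
      rw [Fin.lt_def] at e1 e2
      change 0 < _ at e1
      change _ < 1 at e2
      omega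
    rw [this] at k
    simpa using k

/-- splitting the 5-cycle -/
lemma nu_down {n l : ℕ} {g : Perm (Fin n)} (hg : fullCycleType n g = nu n l) :
    ∃ h, Raise g h ∧ fullCycleType n h = lam n (l + 1) ∧ K0 h + 2 ≤ K0 g := by
  classical
  obtain ⟨x, hx⟩ := fct_exists g 5 (by rw [hg]; simp [nu])
  have hc := cyc_of g x
  have hx' : Function.minimalPeriod g x = 5 := hx
  rw [hx'] at hc
  set c : ℕ → Fin n := fun t => (g ^ t) x with hcd
  obtain ⟨s, _, hs⟩ := par_exists (fun s => c s < c (s + 2)) 5 (by decide) (by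
    intro s
    show c (s + 5) < c (s + 5 + 2) ↔ _
    rw [hc.per, show s + 5 + 2 = s + 2 + 5 by ring, hc.per])
  have hs : c s < c (s + 2) ↔ g (c s) < g (c (s + 2)) := by
    rw [← hc.succ, ← hc.succ]; exact hs
  have dd : ∀ i j, (s + i) % 5 ≠ (s + j) % 5 → c (s + i) ≠ c (s + j) :=
    fun i j h e => h (hc.inj_mod e)
  have hty : fullCycleType n (g * swap (c s) (c (s + 2))) = lam n (l + 1) := by
    refine (split5 g (c (s + 0)) (c (s + 1)) (c (s + 2)) (c (s + 3)) (c (s + 4)) (hc.succ _).symm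
      (hc.succ _).symm (hc.succ _).symm (hc.succ _).symm ?_ ?_ ?_ ?_ ?_ ?_ ?_ ?_ ?_ ?_ ?_).mpr hg
    · rw [← hc.succ]; exact hc.per s
    all_goals
      apply dd; omega
  have hne : c s ≠ c (s + 2) := dd 0 2 (by omega)
  rcases lt_or_gt_of_ne hne with h | h
  · have k := K0_swap g h (hs.mp h)
    exact ⟨_, ⟨_, _, h, hs.mp h, rfl⟩, hty, by omega⟩
  · have h' : g (c (s + 2)) < g (c s) := by
      refine lt_of_le_of_ne (not_lt.mp fun e => h.asymm (hs.mpr e)) fun e => hne (g.injective e.symm)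
    have k := K0_swap g h h'
    rw [swap_comm] at hty
    exact ⟨_, ⟨_, _, h, h', rfl⟩, hty, by omega⟩

lemma conv1 {n k l : ℕ} (hn : 3 * k + 2 ≤ n) (hlk : l ≤ k) : classLE n (lam n k) (lam n l) := by
  intro x hx
  rw [min_iff] at hx
  obtain ⟨g', h1, h2, _⟩ := lam_chain (gmin_tight (by omega) hx) (k - l) (by omega)
  have e : l + (k - l) = k := by omega
  rw [e] at h2
  refine ⟨g' * Fin.revPerm, ?_, ?_⟩
  · rw [min_iff, rev_rev_mul]; exact h2.gmin
  · apply bruhat_of_raise; rw [rev_rev_mul]; exact h1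

lemma conv2 {n k l : ℕ} (hn : 3 * k + 2 ≤ n) (hlk : l + 1 ≤ k) : classLE n (lam n k) (nu n l) := by
  intro x hx
  rw [min_iff] at hx
  obtain ⟨h, hr, hty, hK⟩ := nu_down hx.1
  obtain ⟨h0, g0, hT, hg0, hK0⟩ := nu_upper (n := n) (l := l) (by omega)
  have hT' : Tight n (l + 1) h := by
    have := hx.2 g0 hg0
    have := lam_lower hty
    have := hT.2
    exact ⟨hty, by omega⟩
  obtain ⟨g', h1, h2, _⟩ := lam_chain hT' (k - (l + 1)) (by omega)
  have e : l + 1 + (k - (l + 1)) = k := by omega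
  rw [e] at h2
  refine ⟨g' * Fin.revPerm, ?_, ?_⟩
  · rw [min_iff, rev_rev_mul]; exact h2.gmin
  · apply bruhat_of_raise; rw [rev_rev_mul]; exact (Relation.ReflTransGen.single hr).trans h1

/-- comparison of lengths -/
lemma classLE_K0 {n : ℕ} {la mu : Multiset ℕ} (h : classLE n la mu) {g : Perm (Fin n)}
    (hg : Gmin n mu g) : ∃ g', Gmin n la g' ∧ K0 g' ≤ K0 g := by
  obtain ⟨x', hx', hb⟩ := h (g * Fin.revPerm) ((min_iff _ _).mpr (by rw [rev_rev_mul]; exact hg))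
  refine ⟨x' * Fin.revPerm, (min_iff _ _).mp hx', ?_⟩
  have := bruhat_len hb
  have e1 := permLength_K0 x'
  have e2 := permLength_K0 (g * Fin.revPerm)
  rw [rev_rev_mul] at e2
  omega

lemma tight_lt {n k l : ℕ} (hkl : k < l) (hl : 3 * l + 2 ≤ n) {g h : Perm (Fin n)} (hg : Tight n k g)
    (hh : Tight n l h) : K0 h + 4 ≤ K0 g := by
  have e1 := hg.2
  have e2 := hh.2
  set m := n - 2 - 3 * l with hm
  obtain ⟨d, hd⟩ : ∃ d, n - 2 - 3 * k = m + 3 + d := ⟨n - 2 - 3 * k - m - 3, by omega⟩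
  rw [hd] at e1
  nlinarith [Nat.zero_le (m * d), Nat.zero_le (d * d), Nat.zero_le m, Nat.zero_le d]

lemma main (n k : ℕ) (hn : 3 * k + 2 ≤ n) (mu : Multiset ℕ) (hsum : mu.sum = n)
    (hpos : ∀ p ∈ mu, 0 < p) (hle : classLE n (lam n k) mu) :
    (∃ l, l ≤ k ∧ mu = lam n l) ∨ (∃ l, l + 1 ≤ k ∧ mu = nu n l) ∨
    (∃ l, 3 * l ≤ n ∧ mu = Multiset.replicate l 3 + Multiset.replicate (n - 3 * l) 1) := by
  classical
  obtain ⟨hsh, hcnt⟩ := shape hle hsum hpos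
  obtain ⟨g, hg⟩ := exists_Gmin mu (exists_fct mu hsum hpos)
  have hdec : mu = Multiset.replicate (mu.count 1) 1 + Multiset.replicate (mu.count 2) 2 +
      Multiset.replicate (mu.count 3) 3 + Multiset.replicate (mu.count 5) 5 := by
    ext p
    simp only [Multiset.count_add, Multiset.count_replicate]
    by_cases hp : p ∈ mu
    · rcases hsh p hp with rfl | rfl | rfl | rfl <;> simp
    · have := Multiset.count_eq_zero.mpr hp
      rw [this]
      split_ifs <;> subst_vars <;> simp_all
  generalize mu.count 1 = c1 at *
  generalize mu.count 2 = c2 at *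
  generalize mu.count 3 = c3 at *
  generalize mu.count 5 = c5 at *
  have hs : c1 + 2 * c2 + 3 * c3 + 5 * c5 = n := by
    rw [← hsum, hdec]; simp; ring
  obtain ⟨rfl, rfl⟩ | ⟨rfl, rfl⟩ | ⟨rfl, rfl⟩ : (c2 = 1 ∧ c5 = 0) ∨ (c2 = 0 ∧ c5 = 1) ∨ (c2 = 0 ∧ c5 = 0) := by
    omega
  · left
    have e : mu = lam n c3 := by
      rw [hdec, show c1 = n - 2 - 3 * c3 by omega]
      ext p
      rw [lam_count]
      simp only [Multiset.count_add, Multiset.count_replicate]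
      split_ifs <;> omega
    refine ⟨c3, ?_, e⟩
    by_contra hcon
    rw [e] at hle hg
    obtain ⟨g', hg', hK⟩ := classLE_K0 hle hg
    have := tight_lt (not_le.mp hcon) (by omega) (gmin_tight hn hg') (gmin_tight (by omega) hg)
    omega
  · right; left
    have e : mu = nu n c3 := by
      rw [hdec, show c1 = n - 5 - 3 * c3 by omega]
      ext p
      rw [nu_count]
      simp only [Multiset.count_add, Multiset.count_replicate]
      split_ifs <;> omega
    refine ⟨c3, ?_, e⟩
    by_contra hcon
    rw [e] at hle hg
    obtain ⟨g', hg', hK⟩ := classLE_K0 hle hg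
    obtain ⟨h0, g0, hT, hg0, hK0⟩ := nu_upper (n := n) (l := c3) (by omega)
    have := hg.2 g0 hg0
    have := tight_lt (not_le.mp hcon) (by omega) (gmin_tight hn hg') hT
    omega
  · right; right
    refine ⟨c3, by omega, ?_⟩
    rw [hdec, show c1 = n - 3 * c3 by omega]
    ext p
    simp only [Multiset.count_add, Multiset.count_replicate]
    split_ifs <;> omega

end Helpers

/-- For `λ = (3^k, 2, 1^{n−2−3k})`: every partition `μ` of `n` with `O_λ ≤ O_μ` is of
one of the forms (1) `(3^l, 2, 1^{n−2−3l})` with `l ≤ k`, (2) `(5, 3^l, 1^{n−5−3l})`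
with `l ≤ k−1`, or (3) `(3^l, 1^{n−3l})`; and conversely `O_λ ≤ O_μ` for every `μ` of
form (1) or (2). -/
theorem stmt8 (n k : ℕ) (hn : 3 * k + 2 ≤ n) :
    (∀ mu : Multiset ℕ, mu.sum = n → (∀ p ∈ mu, 0 < p) →
      classLE n (Multiset.replicate k 3 + (2 ::ₘ Multiset.replicate (n - 2 - 3 * k) 1)) mu →
        (∃ l : ℕ, l ≤ k ∧
            mu = Multiset.replicate l 3 + (2 ::ₘ Multiset.replicate (n - 2 - 3 * l) 1)) ∨
        (∃ l : ℕ, l + 1 ≤ k ∧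
            mu = 5 ::ₘ (Multiset.replicate l 3 + Multiset.replicate (n - 5 - 3 * l) 1)) ∨
        (∃ l : ℕ, 3 * l ≤ n ∧
            mu = Multiset.replicate l 3 + Multiset.replicate (n - 3 * l) 1)) ∧
    (∀ l : ℕ, l ≤ k →
      classLE n (Multiset.replicate k 3 + (2 ::ₘ Multiset.replicate (n - 2 - 3 * k) 1))
        (Multiset.replicate l 3 + (2 ::ₘ Multiset.replicate (n - 2 - 3 * l) 1))) ∧
    (∀ l : ℕ, l + 1 ≤ k →
      classLE n (Multiset.replicate k 3 + (2 ::ₘ Multiset.replicate (n - 2 - 3 * k) 1))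
        (5 ::ₘ (Multiset.replicate l 3 + Multiset.replicate (n - 5 - 3 * l) 1))) := by
  exact ⟨fun mu h1 h2 h3 => main n k hn mu h1 h2 h3, fun l hl => conv1 hn hl, fun l hl => conv2 hn hl⟩
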